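/- (Generalized localization at the critical exponent.) Let N ≥ 2, let f ∈ L^1(S^N), and suppose f(x) = 0 for all x in a subdomain (open subset) V ⊂ S^N. Then the Fourier–Laplace series of f is Cesàro summable of the critical order α = (N−1)/2 to zero almost everywhere on V: lim_{n→∞} S_n^{(N−1)/2} f(x) = 0 for σ-almost every x ∈ V. -/

import Mathlib

open MeasureTheory Metric Real Filter
open scoped BigOperators ENNReal NNReal RealInnerProductSpace Topology

noncomputable section

/-- The unit sphere `S^N` as a subtype of `ℝ^{N+1}` (with the Euclidean structure). -/
abbrev Sph (N : ℕ) : Type := Metric.sphere (0 : EuclideanSpace ℝ (Fin (N + 1))) 1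

/-- The surface measure `σ` on the sphere `S^N`. -/
def sphMeasure (N : ℕ) : Measure (Sph N) :=
  (volume : Measure (EuclideanSpace ℝ (Fin (N + 1)))).toSphere

/-- The spherical (geodesic) distance `γ(x,y) ∈ [0,π]` between two points of `S^N`. -/
def geoDist {N : ℕ} (x y : Sph N) : ℝ :=
  Real.arccos ⟪(x : EuclideanSpace ℝ (Fin (N + 1))), (y : EuclideanSpace ℝ (Fin (N + 1)))⟫

/-- The spherical ball `B(x,r) = {y : γ(x,y) ≤ r}`. -/
def sphBall {N : ℕ} (x : Sph N) (r : ℝ) : Set (Sph N) := {y | geoDist x y ≤ r}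

/-- The point of the sphere diametrically opposite to `x`. -/
def antipode {N : ℕ} (x : Sph N) : Sph N :=
  ⟨-(x : EuclideanSpace ℝ (Fin (N + 1))), by
    have hx := x.2
    simp only [mem_sphere_iff_norm, sub_zero, norm_neg] at hx ⊢
    exact hx⟩

/-- A spherical harmonic of degree `k` on `S^N`: the restriction to the sphere of a
homogeneous polynomial of degree `k` on `ℝ^{N+1}` annihilated by the Euclidean Laplacian
(equivalently, an eigenfunction of the Laplace–Beltrami operator `−Δ_s` with
eigenvalue `k(k+N−1)`). -/
def IsSphericalHarmonic (N k : ℕ) (g : Sph N → ℝ) : Prop :=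
  ∃ P : MvPolynomial (Fin (N + 1)) ℝ,
    P.IsHomogeneous k ∧
    (∑ i, MvPolynomial.pderiv i (MvPolynomial.pderiv i P)) = 0 ∧
    ∀ x : Sph N, g x = MvPolynomial.eval (fun i => (x : EuclideanSpace ℝ (Fin (N + 1))) i) P

/-- `Y k j`, `j < a k`, is for each `k` an orthonormal basis (w.r.t. `L²(S^N, σ)`)
of the space `ℵ_k` of spherical harmonics of degree `k`. -/
structure IsFourierLaplaceBasis (N : ℕ) (a : ℕ → ℕ) (Y : (k : ℕ) → Fin (a k) → Sph N → ℝ) :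
    Prop where
  harmonic : ∀ k j, IsSphericalHarmonic N k (Y k j)
  orthonormal : ∀ k, ∀ j j' : Fin (a k),
    ∫ x, Y k j x * Y k j' x ∂(sphMeasure N) = if j = j' then 1 else 0
  spanning : ∀ k (g : Sph N → ℝ), IsSphericalHarmonic N k g →
    g ∈ Submodule.span ℝ (Set.range (Y k))

/-- The Cesàro number `A_m^α = Γ(α+m+1)/(Γ(α+1) m!)`. -/
def cesaroA (α : ℝ) (m : ℕ) : ℝ :=
  Real.Gamma (α + m + 1) / (Real.Gamma (α + 1) * (Nat.factorial m))

/-- The Fourier–Laplace coefficient `f_{k,j} = ∫_{S^N} f(y) Y_j^k(y) dσ(y)`. -/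
def flCoeff {N : ℕ} {a : ℕ → ℕ} (Y : (k : ℕ) → Fin (a k) → Sph N → ℝ) (f : Sph N → ℝ)
    (k : ℕ) (j : Fin (a k)) : ℝ :=
  ∫ y, f y * Y k j y ∂(sphMeasure N)

/-- The Cesàro mean of order `α` of the Fourier–Laplace series of `f`:
`S_n^α f(x) = (1/A_n^α) Σ_{k=0}^n A_{n−k}^α Σ_{j=1}^{a_k} f_{k,j} Y_j^k(x)`. -/
def cesaroMean {N : ℕ} {a : ℕ → ℕ} (Y : (k : ℕ) → Fin (a k) → Sph N → ℝ) (α : ℝ)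
    (f : Sph N → ℝ) (n : ℕ) (x : Sph N) : ℝ :=
  (cesaroA α n)⁻¹ *
    ∑ k ∈ Finset.range (n + 1), cesaroA α (n - k) * ∑ j, flCoeff Y f k j * Y k j x

/-- The maximal operator `S_*^α f(x) = sup_{n ≥ 1} |S_n^α f(x)|` (with values in `ℝ≥0∞`). -/
def cesaroMaximal {N : ℕ} {a : ℕ → ℕ} (Y : (k : ℕ) → Fin (a k) → Sph N → ℝ) (α : ℝ)
    (f : Sph N → ℝ) (x : Sph N) : ℝ≥0∞ :=
  ⨆ (n : ℕ) (_ : 1 ≤ n), ENNReal.ofReal |cesaroMean Y α f n x|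

/-- The Hardy–Littlewood maximal function
`f*(x) = sup_{r>0} (1/σ(B(x,r))) ∫_{B(x,r)} |f| dσ` (with values in `ℝ≥0∞`). -/
def hlMaximal {N : ℕ} (f : Sph N → ℝ) (x : Sph N) : ℝ≥0∞ :=
  ⨆ (r : ℝ) (_ : 0 < r),
    (sphMeasure N (sphBall x r))⁻¹ * ∫⁻ y in sphBall x r, ENNReal.ofReal |f y| ∂(sphMeasure N)

/-- The Cesàro means of order `α` of the spectral function:
`Θ^α(x,y,n) = (1/A_n^α) Σ_{k=0}^n A_{n−k}^α Σ_{j=1}^{a_k} Y_j^k(x) Y_j^k(y)`. -/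
def cesaroKernel {N : ℕ} {a : ℕ → ℕ} (Y : (k : ℕ) → Fin (a k) → Sph N → ℝ) (α : ℝ)
    (n : ℕ) (x y : Sph N) : ℝ :=
  (cesaroA α n)⁻¹ *
    ∑ k ∈ Finset.range (n + 1), cesaroA α (n - k) * ∑ j, Y k j x * Y k j y

/-- The ambient Euclidean space `ℝ^{N+1}`. -/
abbrev Amb (N : ℕ) : Type := EuclideanSpace ℝ (Fin (N + 1))

/-- Evaluation of a polynomial at a point of the ambient Euclidean space. -/
def polyEval {N : ℕ} (p : MvPolynomial (Fin (N + 1)) ℝ) (x : Amb N) : ℝ :=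
  MvPolynomial.eval (fun i => x i) p

/-- The integral of a polynomial over the unit sphere. -/
def sphInt {N : ℕ} (p : MvPolynomial (Fin (N + 1)) ℝ) : ℝ :=
  ∫ x : Sph N, polyEval p (x : Amb N) ∂(sphMeasure N)

instance (N : ℕ) : IsFiniteMeasure (sphMeasure N) := by
  unfold sphMeasure; infer_instance

lemma hasFDerivAt_polyEval {N : ℕ} (p : MvPolynomial (Fin (N + 1)) ℝ) (x : Amb N) :
    HasFDerivAt (polyEval p)
      (∑ i, polyEval (MvPolynomial.pderiv i p) x •
        (EuclideanSpace.proj i : Amb N →L[ℝ] ℝ)) x := by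
  induction p using MvPolynomial.induction_on with
  | C a =>
    refine ((hasFDerivAt_const a x).congr_fderiv ?_).congr_of_eventuallyEq
      (Eventually.of_forall fun y => ?_) <;> simp [polyEval]
  | add p q hp hq =>
    have h := hp.add hq
    refine (h.congr_fderiv ?_).congr_of_eventuallyEq (Eventually.of_forall fun y => ?_)
    · simp [polyEval, add_smul, Finset.sum_add_distrib]
    · simp [polyEval]
  | mul_X p j hp =>
    have h := hp.mul ((EuclideanSpace.proj j : Amb N →L[ℝ] ℝ).hasFDerivAt (x := x))
    refine (h.congr_fderiv ?_).congr_of_eventuallyEq (Eventually.of_forall fun y => ?_)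
    · ext v
      simp [polyEval, MvPolynomial.pderiv_X, Pi.single_apply, add_mul, Finset.sum_add_distrib,
        Finset.mul_sum, mul_assoc, apply_ite]
    · simp [polyEval]

lemma continuous_polyEval {N : ℕ} (p : MvPolynomial (Fin (N + 1)) ℝ) :
    Continuous (polyEval p) :=
  continuous_iff_continuousAt.2 fun x => (hasFDerivAt_polyEval p x).continuousAt

lemma fderiv_polyEval_single {N : ℕ} (p : MvPolynomial (Fin (N + 1)) ℝ) (x : Amb N)
    (i : Fin (N + 1)) :
    fderiv ℝ (polyEval p) x (EuclideanSpace.single i 1) =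
      polyEval (MvPolynomial.pderiv i p) x := by
  rw [(hasFDerivAt_polyEval p x).fderiv]
  simp

lemma polyEval_smul_of_isHomogeneous {N m : ℕ} {p : MvPolynomial (Fin (N + 1)) ℝ}
    (hp : p.IsHomogeneous m) (r : ℝ) (x : Amb N) :
    polyEval p (r • x) = r ^ m * polyEval p x := by
  unfold polyEval
  rw [MvPolynomial.eval_eq, MvPolynomial.eval_eq, Finset.mul_sum]
  refine Finset.sum_congr rfl fun d hd => ?_
  have hdm := hp (MvPolynomial.mem_support_iff.1 hd)
  simp only [PiLp.smul_apply, smul_eq_mul, mul_pow, Finset.prod_mul_distrib]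
  rw [Finset.prod_pow_eq_pow_sum]
  have : ∑ i ∈ d.support, d i = m := by
    rw [← hdm, Finsupp.weight_apply, Finsupp.sum]; simp
  rw [this]; ring

lemma integral_polyEval_mul_radial {N m : ℕ} {p : MvPolynomial (Fin (N + 1)) ℝ}
    (hp : p.IsHomogeneous m) (ψ : ℝ → ℝ) :
    ∫ x : Amb N, polyEval p x * ψ ‖x‖ =
      sphInt p * ∫ r in Set.Ioi (0 : ℝ), r ^ (N + m) * ψ r := by
  have hdim : Module.finrank ℝ (Amb N) - 1 = N := by simp
  calc
    ∫ x : Amb N, polyEval p x * ψ ‖x‖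
      = ∫ x : ({(0)}ᶜ : Set (Amb N)), polyEval p x.1 * ψ ‖x.1‖
          ∂((volume : Measure (Amb N)).comap (↑)) := by
      rw [integral_subtype_comap (measurableSet_singleton _).compl
        fun x : Amb N ↦ polyEval p x * ψ (‖x‖), restrict_compl_singleton]
    _ = ∫ z : Sph N × Set.Ioi (0 : ℝ), polyEval p (z.1 : Amb N) * (z.2.1 ^ m * ψ z.2.1)
          ∂((sphMeasure N).prod (.volumeIoiPow N)) := by
      have := ((volume : Measure (Amb N)).measurePreserving_homeomorphUnitSphereProd).integral_comp
        (Homeomorph.measurableEmbedding _)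
        (fun z : Sph N × Set.Ioi (0 : ℝ) => polyEval p (z.1 : Amb N) * (z.2.1 ^ m * ψ z.2.1))
      rw [hdim] at this
      rw [sphMeasure, ← this]
      refine integral_congr_ae (Eventually.of_forall fun x => ?_)
      have hx : ‖x.1‖ ≠ 0 := norm_ne_zero_iff.2 x.2
      have h1 : polyEval p x.1 = ‖x.1‖ ^ m * polyEval p (‖x.1‖⁻¹ • x.1) := by
        rw [← polyEval_smul_of_isHomogeneous hp, smul_smul, mul_inv_cancel₀ hx, one_smul]
      simp only [homeomorphUnitSphereProd_apply_snd_coe, homeomorphUnitSphereProd_apply_fst_coe]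
      rw [h1]; ring
    _ = sphInt p * ∫ r : Set.Ioi (0 : ℝ), r.1 ^ m * ψ r.1 ∂.volumeIoiPow N := by
      rw [integral_prod_mul (fun x : Sph N => polyEval p (x : Amb N))
        (fun r : Set.Ioi (0 : ℝ) => r.1 ^ m * ψ r.1)]
      rfl
    _ = _ := by
      congr 1
      simp only [Measure.volumeIoiPow, ENNReal.ofReal]
      rw [integral_withDensity_eq_integral_smul,
        integral_subtype_comap measurableSet_Ioi fun a ↦ Real.toNNReal (a ^ N) • (a ^ m * ψ a),
        setIntegral_congr_fun measurableSet_Ioi fun x hx ↦ ?_]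
      · rw [NNReal.smul_def, Real.coe_toNNReal _ (pow_nonneg hx.out.le _)]
        simp only [smul_eq_mul]; ring
      · exact (measurable_subtype_coe.pow_const _).real_toNNReal

/-- A smooth radial cutoff profile: `1` on `(-∞,1]`, `0` on `[2,∞)`. -/
def cutoff (s : ℝ) : ℝ := Real.smoothTransition (2 - s)

lemma contDiff_cutoff : ContDiff ℝ 2 cutoff :=
  Real.smoothTransition.contDiff.comp (contDiff_const.sub contDiff_id)

lemma cutoff_eq_zero {s : ℝ} (hs : 2 ≤ s) : cutoff s = 0 :=
  Real.smoothTransition.zero_of_nonpos (by linarith)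

lemma cutoff_nonneg (s : ℝ) : 0 ≤ cutoff s := Real.smoothTransition.nonneg _

lemma cutoff_pos {s : ℝ} (hs : s < 2) : 0 < cutoff s :=
  Real.smoothTransition.pos_of_pos (by linarith)

lemma hasCompactSupport_cutoff_norm_sq (E : Type*) [NormedAddCommGroup E] [ProperSpace E] :
    HasCompactSupport (fun x : E => cutoff (‖x‖ ^ 2)) := by
  refine HasCompactSupport.intro (isCompact_closedBall (0 : E) 2) fun x hx => cutoff_eq_zero ?_
  simp only [Metric.mem_closedBall, dist_zero_right, not_le] at hx
  nlinarith

lemma deriv_cutoff_eq_zero {s : ℝ} (hs : 2 < s) : deriv cutoff s = 0 := by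
  have : cutoff =ᶠ[𝓝 s] fun _ => 0 := by
    filter_upwards [Ioi_mem_nhds hs] with t ht using cutoff_eq_zero (le_of_lt ht)
  rw [this.deriv_eq]; simp

lemma continuous_deriv_cutoff : Continuous (deriv cutoff) :=
  contDiff_cutoff.continuous_deriv (by norm_num)

lemma hasDerivAt_cutoff (s : ℝ) : HasDerivAt cutoff (deriv cutoff s) s :=
  ((contDiff_cutoff.differentiable (by norm_num)) s).hasDerivAt

lemma integral_pow_mul_deriv_cutoff (M : ℕ) :
    ∫ r in Set.Ioi (0 : ℝ), r ^ (M + 2) * (2 * deriv cutoff (r ^ 2)) =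
      -((M + 1) * ∫ r in Set.Ioi (0 : ℝ), r ^ M * cutoff (r ^ 2)) := by
  have hcs : HasCompactSupport fun r : ℝ => cutoff (r ^ 2) := by
    simpa using hasCompactSupport_cutoff_norm_sq ℝ
  have hcs' : HasCompactSupport fun r : ℝ => deriv cutoff (r ^ 2) := by
    refine HasCompactSupport.intro (isCompact_closedBall (0 : ℝ) 2)
      fun x hx => deriv_cutoff_eq_zero ?_
    simp only [Metric.mem_closedBall, dist_zero_right, not_le, Real.norm_eq_abs] at hx
    rw [← sq_abs]; nlinarith
  have hc : Continuous cutoff := contDiff_cutoff.continuous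
  have hc' := continuous_deriv_cutoff
  have i1 : Integrable fun r : ℝ => r ^ M * cutoff (r ^ 2) :=
    Continuous.integrable_of_hasCompactSupport (by fun_prop) hcs.mul_left
  have i2 : Integrable fun r : ℝ => r ^ (M + 2) * (2 * deriv cutoff (r ^ 2)) :=
    Continuous.integrable_of_hasCompactSupport (by fun_prop) (hcs'.mul_left).mul_left
  have hd : ∀ r ∈ Set.Ici (0 : ℝ), HasDerivAt (fun r : ℝ => r ^ (M + 1) * cutoff (r ^ 2))
      ((M + 1) * (r ^ M * cutoff (r ^ 2)) + r ^ (M + 2) * (2 * deriv cutoff (r ^ 2))) r := by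
    intro r _
    have h1 : HasDerivAt (fun r : ℝ => cutoff (r ^ 2)) (deriv cutoff (r ^ 2) * (2 * r)) r := by
      have h2 : HasDerivAt (fun r : ℝ => r ^ 2) (2 * r) r := by simpa using hasDerivAt_pow 2 r
      exact HasDerivAt.comp (h₂ := cutoff) r (hasDerivAt_cutoff (r ^ 2)) h2
    have h3 : HasDerivAt (fun r : ℝ => r ^ (M + 1) * cutoff (r ^ 2))
        (((M + 1 : ℕ) : ℝ) * r ^ (M + 1 - 1) * cutoff (r ^ 2) +
          r ^ (M + 1) * (deriv cutoff (r ^ 2) * (2 * r))) r := (hasDerivAt_pow (M + 1) r).mul h1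
    refine h3.congr_deriv ?_
    push_cast
    ring
  have hlim : Tendsto (fun r : ℝ => r ^ (M + 1) * cutoff (r ^ 2)) atTop (𝓝 0) := by
    refine tendsto_const_nhds.congr' ?_
    filter_upwards [eventually_ge_atTop 2] with r hr
    rw [cutoff_eq_zero (by nlinarith), mul_zero]
  have key := integral_Ioi_of_hasDerivAt_of_tendsto' hd
    ((i1.const_mul _).add i2).integrableOn hlim
  rw [integral_add (i1.const_mul _).integrableOn i2.integrableOn, integral_const_mul] at key
  simp at key
  linarith

lemma integral_pow_mul_cutoff_pos (M : ℕ) :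
    0 < ∫ r in Set.Ioi (0 : ℝ), r ^ M * cutoff (r ^ 2) := by
  have hcs : HasCompactSupport fun r : ℝ => cutoff (r ^ 2) := by
    simpa using hasCompactSupport_cutoff_norm_sq ℝ
  have hc : Continuous cutoff := contDiff_cutoff.continuous
  have i1 : Integrable fun r : ℝ => r ^ M * cutoff (r ^ 2) :=
    Continuous.integrable_of_hasCompactSupport (by fun_prop) hcs.mul_left
  rw [setIntegral_pos_iff_support_of_nonneg_ae]
  · refine lt_of_lt_of_le (b := volume (Set.Ioo (0 : ℝ) 1)) (by simp) (measure_mono ?_)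
    rintro r ⟨h0, h1⟩
    refine ⟨?_, h0⟩
    have : 0 < cutoff (r ^ 2) := cutoff_pos (by nlinarith)
    exact (mul_pos (pow_pos h0 _) this).ne'
  · filter_upwards [ae_restrict_mem measurableSet_Ioi] with r hr
    exact mul_nonneg (pow_nonneg (le_of_lt hr) _) (cutoff_nonneg _)
  · exact i1.integrableOn

/-- The divergence theorem on the sphere for homogeneous polynomials. -/
lemma sphInt_pderiv {N m : ℕ} {p : MvPolynomial (Fin (N + 1)) ℝ} (hp : p.IsHomogeneous m)
    (hNm : 1 ≤ N) (i : Fin (N + 1)) :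
    sphInt (MvPolynomial.pderiv i p) = (N + m) * sphInt (MvPolynomial.X i * p) := by
  have hc : Continuous cutoff := contDiff_cutoff.continuous
  have hc' := continuous_deriv_cutoff
  have hcs := hasCompactSupport_cutoff_norm_sq (Amb N)
  have hcs' : HasCompactSupport fun x : Amb N => deriv cutoff (‖x‖ ^ 2) := by
    refine HasCompactSupport.intro (isCompact_closedBall (0 : Amb N) 2)
      fun x hx => deriv_cutoff_eq_zero ?_
    simp only [Metric.mem_closedBall, dist_zero_right, not_le] at hx
    nlinarith
  have hg : ∀ x : Amb N, HasFDerivAt (fun x : Amb N => cutoff (‖x‖ ^ 2))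
      (deriv cutoff (‖x‖ ^ 2) • (2 • innerSL ℝ x)) x := fun x =>
    HasDerivAt.comp_hasFDerivAt (h₂ := cutoff) x (hasDerivAt_cutoff (‖x‖ ^ 2))
      (hasStrictFDerivAt_norm_sq x).hasFDerivAt
  have hg1 : ∀ x : Amb N, fderiv ℝ (fun x : Amb N => cutoff (‖x‖ ^ 2)) x
      (EuclideanSpace.single i 1) = 2 * deriv cutoff (‖x‖ ^ 2) * x i := by
    intro x
    rw [(hg x).fderiv]
    simp [EuclideanSpace.inner_single_right]
    ring
  have key := integral_mul_fderiv_eq_neg_fderiv_mul_of_integrable (μ := (volume : Measure (Amb N)))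
    (f := polyEval p) (g := fun x : Amb N => cutoff (‖x‖ ^ 2)) (v := EuclideanSpace.single i 1)
    ?_ ?_ ?_ (fun x _ => (hasFDerivAt_polyEval p x).differentiableAt)
    (fun x _ => (hg x).differentiableAt)
  · have e1 : ∫ x : Amb N, polyEval p x * fderiv ℝ (fun x : Amb N => cutoff (‖x‖ ^ 2)) x
        (EuclideanSpace.single i 1) =
        sphInt (MvPolynomial.X i * p) *
          ∫ r in Set.Ioi (0 : ℝ), r ^ (N + (1 + m)) * (2 * deriv cutoff (r ^ 2)) := by
      rw [← integral_polyEval_mul_radial ((MvPolynomial.isHomogeneous_X ℝ i).mul hp)]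
      refine integral_congr_ae (Eventually.of_forall fun x => ?_)
      simp only [hg1, polyEval, map_mul, MvPolynomial.eval_X]
      ring
    have e2 : ∫ x : Amb N, fderiv ℝ (polyEval p) x (EuclideanSpace.single i 1) *
        cutoff (‖x‖ ^ 2) = sphInt (MvPolynomial.pderiv i p) *
          ∫ r in Set.Ioi (0 : ℝ), r ^ (N + m - 1) * cutoff (r ^ 2) := by
      simp only [fderiv_polyEval_single]
      rcases Nat.eq_zero_or_pos m with rfl | hm
      · rw [← MvPolynomial.totalDegree_zero_iff_isHomogeneous,
          MvPolynomial.totalDegree_eq_zero_iff_eq_C] at hp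
        rw [hp]
        simp [sphInt, polyEval]
      · rw [integral_polyEval_mul_radial hp.pderiv (fun r => cutoff (r ^ 2)),
          ← Nat.add_sub_assoc hm]
    rw [e1, e2] at key
    obtain ⟨M, hM⟩ : ∃ M, N + m = M + 1 := ⟨N + m - 1, by omega⟩
    have hM' : N + m - 1 = M := by omega
    have hM2 : N + (1 + m) = M + 2 := by omega
    have hMr : (N : ℝ) + m = M + 1 := by exact_mod_cast hM
    rw [hM', hM2, integral_pow_mul_deriv_cutoff] at key
    have hpos := integral_pow_mul_cutoff_pos M
    rw [hMr]
    apply mul_right_cancel₀ hpos.ne'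
    linarith
  · simp only [fderiv_polyEval_single]
    have := continuous_polyEval (MvPolynomial.pderiv i p)
    exact Continuous.integrable_of_hasCompactSupport (by fun_prop) hcs.mul_left
  · simp only [hg1]
    have := continuous_polyEval p
    refine Continuous.integrable_of_hasCompactSupport (by fun_prop) ?_
    exact ((hcs'.mul_left (f := fun _ => 2)).mul_right (f' := fun x : Amb N => x i)).mul_left
  · have := continuous_polyEval p
    exact Continuous.integrable_of_hasCompactSupport (by fun_prop) hcs.mul_left

/-- The Euclidean Laplacian on polynomials. -/
def polyLap {N : ℕ} (p : MvPolynomial (Fin (N + 1)) ℝ) : MvPolynomial (Fin (N + 1)) ℝ :=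
  ∑ i, MvPolynomial.pderiv i (MvPolynomial.pderiv i p)

/-- The polynomial `|x|²`. -/
def normSqPoly (N : ℕ) : MvPolynomial (Fin (N + 1)) ℝ := ∑ i, MvPolynomial.X i ^ 2

/-- The linear form `x ↦ ⟨x, y⟩`. -/
def linForm {N : ℕ} (y : Fin (N + 1) → ℝ) : MvPolynomial (Fin (N + 1)) ℝ :=
  ∑ i, MvPolynomial.C (y i) * MvPolynomial.X i

/-- The derivative in the direction `y`. -/
def dirDeriv {N : ℕ} (y : Fin (N + 1) → ℝ) (p : MvPolynomial (Fin (N + 1)) ℝ) :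
    MvPolynomial (Fin (N + 1)) ℝ :=
  ∑ i, MvPolynomial.C (y i) * MvPolynomial.pderiv i p

section Algebra

open MvPolynomial

variable {N : ℕ}

lemma pderiv_linForm (y : Fin (N + 1) → ℝ) (i : Fin (N + 1)) :
    pderiv i (linForm y) = C (y i) := by
  simp [linForm, pderiv_X, Pi.single_apply]

lemma pderiv_normSqPoly (i : Fin (N + 1)) :
    pderiv i (normSqPoly N) = 2 * X i := by
  simp [normSqPoly, Derivation.leibniz_pow, pderiv_X, Pi.single_apply]

lemma dirDeriv_mul (y : Fin (N + 1) → ℝ) (p q : MvPolynomial (Fin (N + 1)) ℝ) :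
    dirDeriv y (p * q) = dirDeriv y p * q + p * dirDeriv y q := by
  simp only [dirDeriv, Derivation.leibniz, smul_eq_mul, Finset.sum_mul, Finset.mul_sum,
    ← Finset.sum_add_distrib]
  exact Finset.sum_congr rfl fun i _ => by ring

lemma dirDeriv_C (y : Fin (N + 1) → ℝ) (a : ℝ) : dirDeriv y (C a) = 0 := by
  simp [dirDeriv]

lemma dirDeriv_sub (y : Fin (N + 1) → ℝ) (p q : MvPolynomial (Fin (N + 1)) ℝ) :
    dirDeriv y (p - q) = dirDeriv y p - dirDeriv y q := by
  simp [dirDeriv, mul_sub, Finset.sum_sub_distrib]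

lemma dirDeriv_linForm {y : Fin (N + 1) → ℝ} (hy : ∑ i, y i ^ 2 = 1) :
    dirDeriv y (linForm y) = 1 := by
  have h : ∀ i, C (y i) * pderiv i (linForm y) = C (y i ^ 2) := fun i => by
    rw [pderiv_linForm, ← C_mul, pow_two]
  rw [dirDeriv, Finset.sum_congr rfl fun i _ => h i, ← map_sum, hy, C_1]

lemma dirDeriv_normSqPoly (y : Fin (N + 1) → ℝ) :
    dirDeriv y (normSqPoly N) = 2 * linForm y := by
  simp only [dirDeriv, pderiv_normSqPoly, linForm, Finset.mul_sum]
  exact Finset.sum_congr rfl fun i _ => by ring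

lemma polyLap_mul (p q : MvPolynomial (Fin (N + 1)) ℝ) :
    polyLap (p * q) = polyLap p * q + 2 * ∑ i, pderiv i p * pderiv i q + p * polyLap q := by
  simp only [polyLap, Derivation.leibniz, smul_eq_mul, map_add, Finset.sum_mul, Finset.mul_sum,
    ← Finset.sum_add_distrib]
  exact Finset.sum_congr rfl fun i _ => by ring

lemma polyLap_C_mul (a : ℝ) (p : MvPolynomial (Fin (N + 1)) ℝ) :
    polyLap (C a * p) = C a * polyLap p := by
  simp [polyLap, Finset.mul_sum]

lemma polyLap_sub (p q : MvPolynomial (Fin (N + 1)) ℝ) :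
    polyLap (p - q) = polyLap p - polyLap q := by
  simp [polyLap, Finset.sum_sub_distrib]

lemma polyLap_linForm_mul (y : Fin (N + 1) → ℝ) (p : MvPolynomial (Fin (N + 1)) ℝ) :
    polyLap (linForm y * p) = 2 * dirDeriv y p + linForm y * polyLap p := by
  have h : polyLap (linForm y) = 0 := by simp [polyLap, pderiv_linForm]
  rw [polyLap_mul, h]
  simp [pderiv_linForm, dirDeriv]

lemma polyLap_normSqPoly : polyLap (normSqPoly N) = 2 * ((N : MvPolynomial _ ℝ) + 1) := by
  have h2 (i : Fin (N + 1)) : pderiv i (2 : MvPolynomial (Fin (N + 1)) ℝ) = 0 := by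
    rw [← map_ofNat (C : ℝ →+* MvPolynomial (Fin (N + 1)) ℝ) 2, pderiv_C]
  simp [polyLap, pderiv_normSqPoly, pderiv_X, h2]
  ring

lemma polyLap_normSqPoly_mul {m : ℕ} {p : MvPolynomial (Fin (N + 1)) ℝ}
    (hp : p.IsHomogeneous m) :
    polyLap (normSqPoly N * p) =
      C (2 * (N + 1) + 4 * m : ℝ) * p + normSqPoly N * polyLap p := by
  have hE := hp.sum_X_mul_pderiv
  have : ∑ i, pderiv i (normSqPoly N) * pderiv i p = 2 * (m • p) := by
    rw [← hE, Finset.mul_sum]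
    exact Finset.sum_congr rfl fun i _ => by rw [pderiv_normSqPoly]; ring
  rw [polyLap_mul, polyLap_normSqPoly, this]
  simp only [nsmul_eq_mul, map_add, map_mul, map_one, map_natCast, map_ofNat]
  ring

/-- The solid zonal harmonic of degree `k` with (unit) pole `y`, i.e. the homogenised Gegenbauer
polynomial `C_k^{(N-1)/2}(⟨x,y⟩)`, defined through the three-term recurrence. -/
def gegPoly (y : Fin (N + 1) → ℝ) : ℕ → MvPolynomial (Fin (N + 1)) ℝ
  | 0 => 1
  | 1 => C (N - 1 : ℝ) * linForm y
  | k + 2 => C ((2 * k + N + 1) / (k + 2) : ℝ) * (linForm y * gegPoly y (k + 1)) -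
      C ((k + N - 1) / (k + 2) : ℝ) * (normSqPoly N * gegPoly y k)

lemma isHomogeneous_linForm (y : Fin (N + 1) → ℝ) : (linForm y).IsHomogeneous 1 :=
  IsHomogeneous.sum _ _ _ fun i _ => by
    simpa using (isHomogeneous_C (Fin (N + 1)) (y i)).mul (isHomogeneous_X ℝ i)

lemma isHomogeneous_normSqPoly : (normSqPoly N).IsHomogeneous 2 :=
  IsHomogeneous.sum _ _ _ fun i _ => by
    simpa using (isHomogeneous_X ℝ i).pow 2

lemma IsHomogeneous.C_mul' {m : ℕ} {p : MvPolynomial (Fin (N + 1)) ℝ} (hp : p.IsHomogeneous m)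
    (a : ℝ) : (C a * p).IsHomogeneous m := by
  simpa using (isHomogeneous_C (Fin (N + 1)) a).mul hp

lemma isHomogeneous_gegPoly (y : Fin (N + 1) → ℝ) : ∀ k, (gegPoly y k).IsHomogeneous k
  | 0 => isHomogeneous_one _ _
  | 1 => IsHomogeneous.C_mul' (isHomogeneous_linForm y) _
  | k + 2 => by
    rw [gegPoly]
    refine IsHomogeneous.sub (IsHomogeneous.C_mul' ?_ _) (IsHomogeneous.C_mul' ?_ _)
    · have := (isHomogeneous_linForm y).mul (isHomogeneous_gegPoly y (k + 1))
      rwa [show 1 + (k + 1) = k + 2 by ring] at this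
    · have := (isHomogeneous_normSqPoly).mul (isHomogeneous_gegPoly y k)
      rwa [show 2 + k = k + 2 by ring] at this

lemma C_mul_gegPoly (y : Fin (N + 1) → ℝ) (k : ℕ) :
    C (k + 2 : ℝ) * gegPoly y (k + 2) =
      C (2 * k + N + 1 : ℝ) * (linForm y * gegPoly y (k + 1)) -
      C (k + N - 1 : ℝ) * (normSqPoly N * gegPoly y k) := by
  have h : (k + 2 : ℝ) ≠ 0 := by positivity
  have h1 (a : ℝ) (q : MvPolynomial (Fin (N + 1)) ℝ) :
      C (k + 2 : ℝ) * (C (a / (k + 2)) * q) = C a * q := by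
    rw [← mul_assoc, ← C_mul, mul_div_cancel₀ _ h]
  rw [gegPoly, mul_sub, h1, h1]

lemma C_mul_left_cancel {a : ℝ} (ha : a ≠ 0) {p q : MvPolynomial (Fin (N + 1)) ℝ}
    (h : C a * p = C a * q) : p = q :=
  mul_left_cancel₀ (by simpa using ha) h

lemma dirDeriv_gegPoly {y : Fin (N + 1) → ℝ} (hy : ∑ i, y i ^ 2 = 1) (k : ℕ) :
    dirDeriv y (gegPoly y (k + 1)) = C (k + N - 1 : ℝ) * gegPoly y k := by
  induction k using Nat.strong_induction_on with
  | _ k ih =>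
  match k, ih with
  | 0, _ =>
    rw [gegPoly, gegPoly, dirDeriv_mul, dirDeriv_C, dirDeriv_linForm hy]
    simp
  | 1, ih =>
    have h1 := ih 0 (by norm_num)
    apply C_mul_left_cancel (a := 2) (by norm_num)
    have h2 := congrArg (dirDeriv y) (C_mul_gegPoly y 0)
    simp only [dirDeriv_sub, dirDeriv_mul, dirDeriv_C, dirDeriv_linForm hy, dirDeriv_normSqPoly,
      h1] at h2
    simp only [gegPoly] at h2 ⊢
    have h3 : dirDeriv y (1 : MvPolynomial (Fin (N + 1)) ℝ) = 0 := by
      simpa using dirDeriv_C y 1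
    simp only [h3, map_add, map_sub, map_mul, map_one, map_natCast, map_ofNat, Nat.cast_zero,
      Nat.cast_one, map_zero] at h2 ⊢
    linear_combination h2
  | k + 2, ih =>
    have h1 := ih (k + 1) (by omega)
    have h0 := ih k (by omega)
    apply C_mul_left_cancel (a := (k + 3 : ℝ)) (by positivity)
    have h2 := congrArg (dirDeriv y) (C_mul_gegPoly y (k + 1))
    have h3 := C_mul_gegPoly y k
    simp only [dirDeriv_sub, dirDeriv_mul, dirDeriv_C, dirDeriv_linForm hy, dirDeriv_normSqPoly,
      h1, h0, show k + 1 + 1 = k + 2 by ring, show k + 1 + 2 = k + 2 + 1 by ring] at h2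
    simp only [map_add, map_sub, map_mul, map_one, map_natCast, map_ofNat, Nat.cast_add,
      Nat.cast_one, Nat.cast_ofNat] at h2 h3 ⊢
    linear_combination h2 - (k + N : MvPolynomial (Fin (N + 1)) ℝ) * h3

lemma polyLap_gegPoly {y : Fin (N + 1) → ℝ} (hy : ∑ i, y i ^ 2 = 1) (k : ℕ) :
    polyLap (gegPoly y k) = 0 := by
  induction k using Nat.strong_induction_on with
  | _ k ih =>
  match k, ih with
  | 0, _ => simp [gegPoly, polyLap]
  | 1, _ => simp [gegPoly, polyLap, pderiv_linForm]
  | k + 2, ih =>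
    have h1 := ih (k + 1) (by omega)
    have h0 := ih k (by omega)
    rw [gegPoly, polyLap_sub, polyLap_C_mul, polyLap_C_mul, polyLap_linForm_mul,
      polyLap_normSqPoly_mul (isHomogeneous_gegPoly y k), h1, h0, dirDeriv_gegPoly hy]
    have e : ((2 * k + N + 1) / (k + 2) : ℝ) * (2 * (k + N - 1)) =
      (k + N - 1) / (k + 2) * (2 * (N + 1) + 4 * k) := by ring
    have e' := congrArg (C : ℝ → MvPolynomial (Fin (N + 1)) ℝ) e
    simp only [C_mul, map_ofNat] at e'
    rw [mul_zero, mul_zero, add_zero, add_zero]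
    linear_combination e' * gegPoly y k

end Algebra

section Reproducing

open MvPolynomial

variable {N : ℕ}

lemma integrable_polyEval (p : MvPolynomial (Fin (N + 1)) ℝ) :
    Integrable (fun x : Sph N => polyEval p (x : Amb N)) (sphMeasure N) :=
  ((continuous_polyEval p).comp continuous_subtype_val).integrable_of_hasCompactSupport
    (HasCompactSupport.of_compactSpace _)

lemma sphInt_add (p q : MvPolynomial (Fin (N + 1)) ℝ) :
    sphInt (p + q) = sphInt p + sphInt q := by
  rw [sphInt, sphInt, sphInt, ← integral_add (integrable_polyEval p) (integrable_polyEval q)]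
  simp [polyEval]

lemma sphInt_sub (p q : MvPolynomial (Fin (N + 1)) ℝ) :
    sphInt (p - q) = sphInt p - sphInt q := by
  rw [sphInt, sphInt, sphInt, ← integral_sub (integrable_polyEval p) (integrable_polyEval q)]
  simp [polyEval]

lemma sphInt_C_mul (a : ℝ) (p : MvPolynomial (Fin (N + 1)) ℝ) :
    sphInt (C a * p) = a * sphInt p := by
  rw [sphInt, sphInt, ← integral_const_mul]
  simp [polyEval]

lemma sphInt_zero : sphInt (0 : MvPolynomial (Fin (N + 1)) ℝ) = 0 := by
  simp [sphInt, polyEval]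

lemma sphInt_sum {ι : Type*} (s : Finset ι) (p : ι → MvPolynomial (Fin (N + 1)) ℝ) :
    sphInt (∑ i ∈ s, p i) = ∑ i ∈ s, sphInt (p i) := by
  classical
  induction s using Finset.induction_on with
  | empty => simp [sphInt_zero]
  | insert i s hi ih => rw [Finset.sum_insert hi, Finset.sum_insert hi, sphInt_add, ih]

lemma sum_coe_sq (x : Sph N) : ∑ i, (x : Amb N) i ^ 2 = 1 := by
  rw [← EuclideanSpace.real_norm_sq_eq, norm_eq_of_mem_sphere, one_pow]

lemma sphInt_normSqPoly_mul (p : MvPolynomial (Fin (N + 1)) ℝ) :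
    sphInt (normSqPoly N * p) = sphInt p := by
  refine integral_congr_ae (Eventually.of_forall fun x => ?_)
  have := sum_coe_sq x
  simp only [polyEval, normSqPoly, map_mul, map_sum, map_pow, eval_X]
  rw [this, one_mul]

lemma sphInt_linForm_mul (hN : 1 ≤ N) (y : Fin (N + 1) → ℝ) {m : ℕ}
    {p : MvPolynomial (Fin (N + 1)) ℝ} (hp : p.IsHomogeneous m) :
    sphInt (dirDeriv y p) = (N + m) * sphInt (linForm y * p) := by
  rw [dirDeriv, linForm, Finset.sum_mul, sphInt_sum, sphInt_sum, Finset.mul_sum]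
  refine Finset.sum_congr rfl fun i _ => ?_
  rw [mul_assoc, sphInt_C_mul, sphInt_C_mul, sphInt_pderiv hp hN]
  ring

lemma sphInt_sum_pderiv_mul_pderiv (hN : 1 ≤ N) {k l : ℕ} {p q : MvPolynomial (Fin (N + 1)) ℝ}
    (hp : p.IsHomogeneous k) (hq : q.IsHomogeneous l) (hq' : polyLap q = 0) :
    sphInt (∑ i, pderiv i p * pderiv i q) = (N + k + l - 1) * l * sphInt (p * q) := by
  rcases l with _ | l
  · rw [← totalDegree_zero_iff_isHomogeneous, totalDegree_eq_zero_iff_eq_C] at hq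
    rw [hq]
    simp [sphInt_zero]
  · have hE := hq.sum_X_mul_pderiv
    have h1 : sphInt (∑ i, X i * (p * pderiv i q)) = (l + 1) * sphInt (p * q) := by
      rw [← sphInt_C_mul]
      congr 1
      calc ∑ i, X i * (p * pderiv i q) = p * ∑ i, X i * pderiv i q := by
            rw [Finset.mul_sum]; exact Finset.sum_congr rfl fun i _ => by ring
        _ = _ := by rw [hE]; simp; ring
    have h2 : sphInt (∑ i, pderiv i (p * pderiv i q)) =
        (N + k + l) * sphInt (∑ i, X i * (p * pderiv i q)) := by
      rw [sphInt_sum, sphInt_sum, Finset.mul_sum]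
      refine Finset.sum_congr rfl fun i _ => ?_
      rw [sphInt_pderiv (hp.mul hq.pderiv) hN, Nat.add_sub_cancel]
      push_cast; ring
    have h3 : ∑ i, pderiv i (p * pderiv i q) = ∑ i, pderiv i p * pderiv i q := by
      have : p * polyLap q = 0 := by rw [hq', mul_zero]
      rw [← add_zero (∑ i, pderiv i p * pderiv i q), ← this, polyLap, Finset.mul_sum,
        ← Finset.sum_add_distrib]
      exact Finset.sum_congr rfl fun i _ => by rw [Derivation.leibniz]; simp; ring
    rw [← h3, h2, h1]
    push_cast; ring

/-- Spherical harmonics of different degrees are orthogonal. -/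
lemma sphInt_mul_eq_zero (hN : 2 ≤ N) {k l : ℕ} (hkl : k ≠ l)
    {p q : MvPolynomial (Fin (N + 1)) ℝ}
    (hp : p.IsHomogeneous k) (hp' : polyLap p = 0)
    (hq : q.IsHomogeneous l) (hq' : polyLap q = 0) : sphInt (p * q) = 0 := by
  have h1 := sphInt_sum_pderiv_mul_pderiv (by omega) hp hq hq'
  have h2 := sphInt_sum_pderiv_mul_pderiv (by omega) hq hp hp'
  simp only [mul_comm q, mul_comm (pderiv _ q)] at h2
  have hN' : (2 : ℝ) ≤ N := by exact_mod_cast hN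
  have h3 : ((N + k + l - 1 : ℝ) * (l - k)) * sphInt (p * q) = 0 := by
    linear_combination h2 - h1
  refine (mul_eq_zero.1 h3).resolve_left (mul_ne_zero ?_ (sub_ne_zero.2 ?_))
  · have : (0 : ℝ) ≤ k := k.cast_nonneg
    have : (0 : ℝ) ≤ l := l.cast_nonneg
    linarith
  · exact_mod_cast hkl.symm

lemma isHomogeneous_dirDeriv (y : Fin (N + 1) → ℝ) {m : ℕ} {p : MvPolynomial (Fin (N + 1)) ℝ}
    (hp : p.IsHomogeneous (m + 1)) : (dirDeriv y p).IsHomogeneous m :=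
  IsHomogeneous.sum _ _ _ fun i _ => IsHomogeneous.C_mul' (by simpa using hp.pderiv (i := i)) _

lemma pderiv_comm (i j : Fin (N + 1)) (p : MvPolynomial (Fin (N + 1)) ℝ) :
    pderiv i (pderiv j p) = pderiv j (pderiv i p) := by
  set D : Fin (N + 1) → Derivation ℝ (MvPolynomial (Fin (N + 1)) ℝ)
    (MvPolynomial (Fin (N + 1)) ℝ) := fun i => pderiv i with hD
  have h : ⁅D i, D j⁆ = 0 := by
    refine derivation_ext fun l => ?_
    simp only [hD, Derivation.commutator_apply, pderiv_X, Pi.single_apply]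
    split_ifs <;> simp
  have := congrArg (fun D => D p) h
  simpa [hD, Derivation.commutator_apply, sub_eq_zero] using this

lemma polyLap_dirDeriv (y : Fin (N + 1) → ℝ) (p : MvPolynomial (Fin (N + 1)) ℝ) :
    polyLap (dirDeriv y p) = dirDeriv y (polyLap p) := by
  simp only [polyLap, dirDeriv, map_sum, Finset.mul_sum, pderiv_C_mul]
  rw [Finset.sum_comm]
  refine Finset.sum_congr rfl fun i _ => Finset.sum_congr rfl fun j _ => ?_
  rw [pderiv_comm i j (pderiv j p), pderiv_comm i j p]

lemma eval_dirDeriv_self (y : Fin (N + 1) → ℝ) {m : ℕ} {p : MvPolynomial (Fin (N + 1)) ℝ}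
    (hp : p.IsHomogeneous m) : eval y (dirDeriv y p) = m * eval y p := by
  have := congrArg (eval y) hp.sum_X_mul_pderiv
  simpa [dirDeriv] using this

/-- The reproducing property of the zonal harmonics. -/
lemma sphInt_gegPoly_mul (hN : 2 ≤ N) {y : Fin (N + 1) → ℝ} (hy : ∑ i, y i ^ 2 = 1) (k : ℕ)
    {h : MvPolynomial (Fin (N + 1)) ℝ} (hh : h.IsHomogeneous k) (hh' : polyLap h = 0) :
    sphInt (gegPoly y k * h) =
      (sphMeasure N).real Set.univ * (N - 1) / (2 * k + N - 1) * eval y h := by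
  have hN' : (2 : ℝ) ≤ N := by exact_mod_cast hN
  have const {p : MvPolynomial (Fin (N + 1)) ℝ} (hp : p.IsHomogeneous 0) :
      sphInt p = (sphMeasure N).real Set.univ * eval y p := by
    rw [← totalDegree_zero_iff_isHomogeneous, totalDegree_eq_zero_iff_eq_C] at hp
    rw [hp]
    simp [sphInt, polyEval]
  induction k using Nat.strong_induction_on generalizing h with
  | _ k ih =>
  match k, ih with
  | 0, _ =>
    rw [gegPoly, one_mul, const hh]
    have : (N - 1 : ℝ) ≠ 0 := by linarith
    simp [this]
  | 1, _ =>
    have h1 := sphInt_linForm_mul (by omega) y hh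
    rw [const (isHomogeneous_dirDeriv y hh), eval_dirDeriv_self y hh] at h1
    rw [gegPoly, mul_assoc, sphInt_C_mul]
    have : (N + 1 : ℝ) ≠ 0 := by linarith
    push_cast at h1 ⊢
    have h2 : sphInt (linForm y * h) = (sphMeasure N).real Set.univ * eval y h / (N + 1) := by
      rw [eq_div_iff this]; linarith
    rw [h2, show (2 * 1 + N - 1 : ℝ) = N + 1 by ring]
    ring
  | k + 2, ih =>
    have hk : (0 : ℝ) ≤ k := k.cast_nonneg
    have hg := isHomogeneous_gegPoly y
    have hl := polyLap_gegPoly hy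
    have h0 : sphInt (gegPoly y k * h) = 0 :=
      sphInt_mul_eq_zero hN (by omega) (hg k) (hl k) hh hh'
    have h1 := ih (k + 1) (by omega) (isHomogeneous_dirDeriv y hh)
      (by rw [polyLap_dirDeriv, hh']; simp [dirDeriv])
    rw [eval_dirDeriv_self y hh] at h1
    have h2 := sphInt_linForm_mul (by omega) y ((hg (k + 1)).mul hh)
    rw [dirDeriv_mul, sphInt_add, dirDeriv_gegPoly hy, mul_assoc, sphInt_C_mul, h0, h1] at h2
    rw [gegPoly, sub_mul, mul_assoc, mul_assoc, mul_assoc, mul_assoc, sphInt_sub, sphInt_C_mul,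
      sphInt_C_mul, sphInt_normSqPoly_mul, h0]
    push_cast at h2 ⊢
    have a1 : (2 * (k + 1) + N - 1 : ℝ) ≠ 0 := by linarith
    have a2 : (2 * (k + 2) + N - 1 : ℝ) ≠ 0 := by linarith
    have a3 : (N + (k + 1 + (k + 2)) : ℝ) ≠ 0 := by linarith
    have a4 : (k + 2 : ℝ) ≠ 0 := by linarith
    have h3 : sphInt (linForm y * (gegPoly y (k + 1) * h)) =
        (sphMeasure N).real Set.univ * (N - 1) / (2 * (k + 1) + N - 1) * ((k + 2) * eval y h) /
          (N + (k + 1 + (k + 2))) := by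
      rw [eq_div_iff a3]; linarith
    rw [h3]
    rw [show (2 * (k + 2) + N - 1 : ℝ) = (N + (k + 1 + (k + 2))) by ring,
      show (2 * (k + 1) + N - 1 : ℝ) = 2 * k + N + 1 by ring] at *
    field_simp
    ring

/-- The addition formula for spherical harmonics. -/
lemma addition_formula (hN : 2 ≤ N) {a : ℕ → ℕ} {Y : (k : ℕ) → Fin (a k) → Sph N → ℝ}
    (hY : IsFourierLaplaceBasis N a Y) (k : ℕ) (x y : Sph N) :
    polyEval (gegPoly (fun i => (y : Amb N) i) k) (x : Amb N) =
      (sphMeasure N).real Set.univ * (N - 1) / (2 * k + N - 1) * ∑ j, Y k j x * Y k j y := by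
  set G := gegPoly (fun i => (y : Amb N) i) k with hG
  have hs := sum_coe_sq y
  have hmem := hY.spanning k (fun x => polyEval G (x : Amb N))
    ⟨G, isHomogeneous_gegPoly _ k, polyLap_gegPoly hs k, fun x => rfl⟩
  obtain ⟨c, hc⟩ := (Submodule.mem_span_range_iff_exists_fun ℝ).1 hmem
  have hcx (x : Sph N) : polyEval G (x : Amb N) = ∑ j, c j * Y k j x := by
    simpa using (congrFun hc x).symm
  choose P hP1 hP2 hP3 using hY.harmonic k
  have h_int (j j' : Fin (a k)) : Integrable (fun x => Y k j x * Y k j' x) (sphMeasure N) := by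
    refine (integrable_polyEval (P j * P j')).congr (Eventually.of_forall fun x => ?_)
    simp [hP3, polyEval]
  have hcj (j : Fin (a k)) : c j =
      (sphMeasure N).real Set.univ * (N - 1) / (2 * k + N - 1) * Y k j y := by
    have h1 := sphInt_gegPoly_mul hN hs k (hP1 j) (hP2 j)
    rw [← hP3] at h1
    rw [← h1, sphInt]
    have : ∀ x : Sph N, polyEval (gegPoly (fun i => (y : Amb N) i) k * P j) (x : Amb N) =
        ∑ j', c j' * (Y k j' x * Y k j x) := fun x => by
      have := hcx x
      simp only [polyEval, map_mul, ← hG] at this ⊢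
      rw [this, ← hP3, Finset.sum_mul]
      simp only [mul_assoc]
    simp_rw [this]
    rw [integral_finsetSum _ fun j' _ => (h_int j' j).const_mul _]
    simp_rw [integral_const_mul, hY.orthonormal]
    simp
  rw [hcx, Finset.mul_sum]
  exact Finset.sum_congr rfl fun j _ => by rw [hcj]; ring

end Reproducing

lemma cesaroA_pos {α : ℝ} (hα : 0 ≤ α) (m : ℕ) : 0 < cesaroA α m := by
  have h1 := Real.Gamma_pos_of_pos (show 0 < α + m + 1 by positivity)
  have h2 := Real.Gamma_pos_of_pos (show 0 < α + 1 by positivity)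
  unfold cesaroA
  positivity

lemma cesaroA_succ {α : ℝ} (hα : 0 ≤ α) (m : ℕ) :
    (m + 1) * cesaroA α (m + 1) = (α + m + 1) * cesaroA α m := by
  have h1 : α + m + 1 ≠ 0 := by positivity
  have h2 := (Real.Gamma_pos_of_pos (show 0 < α + 1 by positivity)).ne'
  have h3 := Real.Gamma_add_one h1
  unfold cesaroA
  rw [Nat.factorial_succ]
  push_cast
  rw [show α + (m + 1) + 1 = α + m + 1 + 1 by ring, h3]
  field_simp

lemma tendsto_cesaroA_div {α : ℝ} (hα : 0 ≤ α) (k : ℕ) :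
    Tendsto (fun n => (cesaroA α (n + k))⁻¹ * cesaroA α n) atTop (𝓝 1) := by
  have h1 : Tendsto (fun n => (cesaroA α (n + 1))⁻¹ * cesaroA α n) atTop (𝓝 1) := by
    have h2 : Tendsto (fun n : ℕ => 1 - α / ((n : ℝ) + (α + 1))) atTop (𝓝 (1 - 0)) :=
      tendsto_const_nhds.sub (tendsto_const_nhds.div_atTop
        (tendsto_atTop_add_const_right _ _ tendsto_natCast_atTop_atTop))
    rw [sub_zero] at h2
    refine h2.congr fun n => ?_
    have h3 := cesaroA_succ hα n
    have h4 := cesaroA_pos hα (n + 1)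
    have h5 : (n : ℝ) + (α + 1) ≠ 0 := by positivity
    field_simp
    linarith
  induction k with
  | zero =>
    refine tendsto_const_nhds.congr fun n => ?_
    rw [Nat.add_zero, inv_mul_cancel₀ (cesaroA_pos hα n).ne']
  | succ k ih =>
    have h6 := (h1.comp (tendsto_add_atTop_nat k)).mul ih
    rw [one_mul] at h6
    refine h6.congr fun n => ?_
    have := cesaroA_pos hα (n + k)
    simp only [Function.comp_apply, ← add_assoc]
    field_simp

section Convergence

variable {N : ℕ} {a : ℕ → ℕ} {Y : (k : ℕ) → Fin (a k) → Sph N → ℝ}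

lemma IsFourierLaplaceBasis.continuous (hY : IsFourierLaplaceBasis N a Y) (k : ℕ) (j : Fin (a k)) :
    Continuous (Y k j) := by
  obtain ⟨P, -, -, hP⟩ := hY.harmonic k j
  have : Y k j = fun x : Sph N => polyEval P (x : Amb N) := funext hP
  rw [this]
  exact (continuous_polyEval P).comp continuous_subtype_val

lemma Continuous.integrable_sphere {f : Sph N → ℝ} (hf : Continuous f) :
    Integrable f (sphMeasure N) :=
  hf.integrable_of_hasCompactSupport (HasCompactSupport.of_compactSpace _)

lemma IsFourierLaplaceBasis.integrable_mul (hY : IsFourierLaplaceBasis N a Y) (k : ℕ)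
    (j : Fin (a k)) {f : Sph N → ℝ} (hf : Integrable f (sphMeasure N)) :
    Integrable (fun y => f y * Y k j y) (sphMeasure N) := by
  obtain ⟨C, hC⟩ := (hY.continuous k j).bounded_above_of_compact_support
    (HasCompactSupport.of_compactSpace _)
  exact hf.mul_bdd (hY.continuous k j).aestronglyMeasurable (Eventually.of_forall hC)

lemma flCoeff_add (hY : IsFourierLaplaceBasis N a Y) {f g : Sph N → ℝ}
    (hf : Integrable f (sphMeasure N)) (hg : Integrable g (sphMeasure N)) (k : ℕ)
    (j : Fin (a k)) : flCoeff Y (fun y => f y + g y) k j = flCoeff Y f k j + flCoeff Y g k j := by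
  simp only [flCoeff, add_mul]
  exact integral_add (hY.integrable_mul k j hf) (hY.integrable_mul k j hg)

lemma cesaroMean_add (hY : IsFourierLaplaceBasis N a Y) (α : ℝ) {f g : Sph N → ℝ}
    (hf : Integrable f (sphMeasure N)) (hg : Integrable g (sphMeasure N)) (n : ℕ) (x : Sph N) :
    cesaroMean Y α (fun y => f y + g y) n x = cesaroMean Y α f n x + cesaroMean Y α g n x := by
  simp only [cesaroMean, flCoeff_add hY hf hg, add_mul, Finset.sum_add_distrib, mul_add]

lemma cesaroMean_eq_of_harmonic (hN : 2 ≤ N) (hY : IsFourierLaplaceBasis N a Y) (α : ℝ) {k : ℕ}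
    {h : MvPolynomial (Fin (N + 1)) ℝ} (hh : h.IsHomogeneous k) (hh' : polyLap h = 0)
    {n : ℕ} (hn : k ≤ n) (x : Sph N) :
    cesaroMean Y α (fun y => polyEval h (y : Amb N)) n x =
      (cesaroA α n)⁻¹ * cesaroA α (n - k) * polyEval h (x : Amb N) := by
  have h1 : ∀ l, l ≠ k → ∀ j, flCoeff Y (fun y => polyEval h (y : Amb N)) l j = 0 := by
    intro l hl j
    obtain ⟨P, hP1, hP2, hP3⟩ := hY.harmonic l j
    rw [← sphInt_mul_eq_zero hN hl.symm hh hh' hP1 hP2, flCoeff, sphInt]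
    simp [polyEval, hP3]
  have h2 : ∑ j, flCoeff Y (fun y => polyEval h (y : Amb N)) k j * Y k j x =
      polyEval h (x : Amb N) := by
    obtain ⟨c, hc⟩ := (Submodule.mem_span_range_iff_exists_fun ℝ).1
      (hY.spanning k (fun x => polyEval h (x : Amb N)) ⟨h, hh, hh', fun x => rfl⟩)
    have hcx (x : Sph N) : polyEval h (x : Amb N) = ∑ j, c j * Y k j x := by
      simpa using (congrFun hc x).symm
    rw [hcx]
    refine Finset.sum_congr rfl fun j _ => ?_
    congr 1
    simp only [flCoeff, hcx, Finset.sum_mul, mul_assoc]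
    rw [integral_finsetSum _ fun j' _ =>
      ((hY.integrable_mul k j (hY.continuous k j').integrable_sphere).const_mul _)]
    simp_rw [integral_const_mul, hY.orthonormal]
    simp
  rw [cesaroMean, Finset.sum_eq_single k, h2, mul_assoc]
  · intro l _ hl
    simp [h1 l hl]
  · intro hk
    exact absurd (Finset.mem_range.2 (by omega)) hk

lemma polyLap_isHomogeneous {m : ℕ} {p : MvPolynomial (Fin (N + 1)) ℝ} (hp : p.IsHomogeneous m) :
    (polyLap p).IsHomogeneous (m - 2) :=
  MvPolynomial.IsHomogeneous.sum _ _ _ fun _ _ => hp.pderiv.pderiv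

lemma iterate_polyLap_isHomogeneous (j : ℕ) {m : ℕ} {p : MvPolynomial (Fin (N + 1)) ℝ}
    (hp : p.IsHomogeneous m) : (polyLap^[j] p).IsHomogeneous (m - 2 * j) := by
  induction j with
  | zero => simpa using hp
  | succ j ih =>
    rw [Function.iterate_succ_apply']
    have := polyLap_isHomogeneous ih
    rwa [show m - 2 * j - 2 = m - 2 * (j + 1) by omega] at this

lemma iterate_polyLap_zero (j : ℕ) : polyLap^[j] (0 : MvPolynomial (Fin (N + 1)) ℝ) = 0 :=
  Function.iterate_fixed (by simp [polyLap]) j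

lemma iterate_polyLap_eq_zero (j : ℕ) {m : ℕ} (hm : m < 2 * j)
    {p : MvPolynomial (Fin (N + 1)) ℝ} (hp : p.IsHomogeneous m) : polyLap^[j] p = 0 := by
  induction j generalizing m p with
  | zero => omega
  | succ j ih =>
    rw [Function.iterate_succ_apply]
    rcases Nat.lt_or_ge m 2 with h | h
    · have : polyLap p = 0 := by
        refine Finset.sum_eq_zero fun i _ => ?_
        have hi := hp.pderiv (i := i)
        rw [show m - 1 = 0 by omega, ← MvPolynomial.totalDegree_zero_iff_isHomogeneous,
          MvPolynomial.totalDegree_eq_zero_iff_eq_C] at hi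
        rw [hi, MvPolynomial.pderiv_C]
      rw [this, iterate_polyLap_zero]
    · exact ih (by omega) (polyLap_isHomogeneous hp)

lemma iterate_polyLap_C_mul (j : ℕ) (c : ℝ) (p : MvPolynomial (Fin (N + 1)) ℝ) :
    polyLap^[j] (MvPolynomial.C c * p) = MvPolynomial.C c * polyLap^[j] p := by
  induction j with
  | zero => rfl
  | succ j ih => rw [Function.iterate_succ_apply', ih, polyLap_C_mul, Function.iterate_succ_apply']

lemma iterate_polyLap_sub (j : ℕ) (p q : MvPolynomial (Fin (N + 1)) ℝ) :
    polyLap^[j] (p - q) = polyLap^[j] p - polyLap^[j] q := by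
  induction j with
  | zero => rfl
  | succ j ih => simp only [Function.iterate_succ_apply', ih, polyLap_sub]

lemma isHomogeneous_normSqPoly_pow_mul (j : ℕ) {m : ℕ} {g : MvPolynomial (Fin (N + 1)) ℝ}
    (hg : g.IsHomogeneous m) : (normSqPoly N ^ j * g).IsHomogeneous (m + 2 * j) := by
  have := (isHomogeneous_normSqPoly (N := N)).pow j |>.mul hg
  rwa [add_comm (2 * j)] at this

lemma polyLap_normSqPoly_pow_mul {m : ℕ} {g : MvPolynomial (Fin (N + 1)) ℝ}
    (hg : g.IsHomogeneous m) (hg' : polyLap g = 0) (j : ℕ) :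
    ∃ c : ℝ, 0 < c ∧ polyLap (normSqPoly N ^ (j + 1) * g) =
      MvPolynomial.C c * (normSqPoly N ^ j * g) := by
  induction j with
  | zero =>
    refine ⟨_, ?_, by rw [zero_add, pow_one, polyLap_normSqPoly_mul hg, hg', mul_zero, add_zero,
      pow_zero, one_mul]⟩
    positivity
  | succ j ih =>
    obtain ⟨c, hc, h⟩ := ih
    have hj := isHomogeneous_normSqPoly_pow_mul (j + 1) hg
    refine ⟨2 * (N + 1) + 4 * ((m + 2 * (j + 1) : ℕ) : ℝ) + c, by positivity, ?_⟩
    rw [pow_succ' _ (j + 1), mul_assoc, polyLap_normSqPoly_mul hj, h,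
      map_add MvPolynomial.C _ c]
    ring

lemma iterate_polyLap_normSqPoly_pow_mul {m : ℕ} {g : MvPolynomial (Fin (N + 1)) ℝ}
    (hg : g.IsHomogeneous m) (hg' : polyLap g = 0) (j : ℕ) :
    ∃ c : ℝ, 0 < c ∧ polyLap^[j] (normSqPoly N ^ j * g) = MvPolynomial.C c * g := by
  induction j with
  | zero => exact ⟨1, one_pos, by simp⟩
  | succ j ih =>
    obtain ⟨c, hc, h⟩ := ih
    obtain ⟨d, hd, h'⟩ := polyLap_normSqPoly_pow_mul hg hg' j
    refine ⟨d * c, by positivity, ?_⟩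
    rw [Function.iterate_succ_apply, h', iterate_polyLap_C_mul, h, MvPolynomial.C_mul, mul_assoc]

/-- The Cesàro means of a polynomial converge to it everywhere on the sphere. -/
lemma tendsto_cesaroMean_polyEval (hN : 2 ≤ N) (hY : IsFourierLaplaceBasis N a Y) {α : ℝ}
    (hα : 0 ≤ α) (p : MvPolynomial (Fin (N + 1)) ℝ) (x : Sph N) :
    Tendsto (fun n => cesaroMean Y α (fun y => polyEval p (y : Amb N)) n x) atTop
      (𝓝 (polyEval p (x : Amb N))) := by
  have hadd : ∀ p q r : MvPolynomial (Fin (N + 1)) ℝ,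
      (∀ y : Sph N, polyEval r (y : Amb N) = polyEval p (y : Amb N) + polyEval q (y : Amb N)) →
      Tendsto (fun n => cesaroMean Y α (fun y => polyEval p (y : Amb N)) n x) atTop
        (𝓝 (polyEval p (x : Amb N))) →
      Tendsto (fun n => cesaroMean Y α (fun y => polyEval q (y : Amb N)) n x) atTop
        (𝓝 (polyEval q (x : Amb N))) →
      Tendsto (fun n => cesaroMean Y α (fun y => polyEval r (y : Amb N)) n x) atTop
        (𝓝 (polyEval r (x : Amb N))) := by
    intro p q r h hp hq
    simp only [h]
    refine (hp.add hq).congr fun n => ?_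
    rw [cesaroMean_add hY α (integrable_polyEval p) (integrable_polyEval q)]
  have hzero : Tendsto (fun n => cesaroMean Y α (fun y =>
      polyEval (0 : MvPolynomial (Fin (N + 1)) ℝ) (y : Amb N)) n x) atTop
        (𝓝 (polyEval (0 : MvPolynomial (Fin (N + 1)) ℝ) (x : Amb N))) := by
    simp [polyEval, cesaroMean, flCoeff]
  have hharm : ∀ (k : ℕ) (h : MvPolynomial (Fin (N + 1)) ℝ), h.IsHomogeneous k → polyLap h = 0 →
      Tendsto (fun n => cesaroMean Y α (fun y => polyEval h (y : Amb N)) n x) atTop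
        (𝓝 (polyEval h (x : Amb N))) := by
    intro k h hh hh'
    rw [← tendsto_add_atTop_iff_nat k]
    have := (tendsto_cesaroA_div hα k).mul_const (polyEval h (x : Amb N))
    rw [one_mul] at this
    refine this.congr fun n => ?_
    rw [cesaroMean_eq_of_harmonic hN hY α hh hh' (Nat.le_add_left k n), Nat.add_sub_cancel]
  have hhom : ∀ (j k : ℕ) (p : MvPolynomial (Fin (N + 1)) ℝ), p.IsHomogeneous k →
      polyLap^[j] p = 0 →
      Tendsto (fun n => cesaroMean Y α (fun y => polyEval p (y : Amb N)) n x) atTop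
        (𝓝 (polyEval p (x : Amb N))) := by
    intro j
    induction j with
    | zero =>
      intro k p _ hp
      rw [Function.iterate_zero_apply] at hp
      rw [hp]; exact hzero
    | succ j ih =>
      intro k p hp hpj
      rcases Nat.lt_or_ge k (2 * j) with hk | hk
      · exact ih k p hp (iterate_polyLap_eq_zero j hk hp)
      · rw [Function.iterate_succ_apply'] at hpj
        have hg := iterate_polyLap_isHomogeneous j hp
        obtain ⟨c, hc, hcj⟩ := iterate_polyLap_normSqPoly_pow_mul hg hpj j
        have hg2 := isHomogeneous_normSqPoly_pow_mul j hg
        rw [Nat.sub_add_cancel hk] at hg2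
        set g := polyLap^[j] p
        have hcg : (MvPolynomial.C c⁻¹ * g).IsHomogeneous (k - 2 * j) :=
          IsHomogeneous.C_mul' hg _
        refine hadd (p - MvPolynomial.C c⁻¹ * (normSqPoly N ^ j * g)) (MvPolynomial.C c⁻¹ * g) p
          (fun y => ?_) (ih k _ (hp.sub (IsHomogeneous.C_mul' hg2 _)) ?_) (hharm _ _ hcg ?_)
        · have := sum_coe_sq y
          simp only [polyEval, normSqPoly, map_sub, map_mul, map_pow, map_sum,
            MvPolynomial.eval_X, MvPolynomial.eval_C]
          rw [this]; ring
        · rw [iterate_polyLap_sub, iterate_polyLap_C_mul, hcj, ← mul_assoc, ← MvPolynomial.C_mul,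
            inv_mul_cancel₀ hc.ne', MvPolynomial.C_1, one_mul, sub_self]
        · rw [polyLap_C_mul, hpj, mul_zero]
  induction p using MvPolynomial.induction_on' with
  | monomial d c =>
    exact hhom (d.degree + 1) _ _ (MvPolynomial.isHomogeneous_monomial c rfl)
      (iterate_polyLap_eq_zero _ (by omega) (MvPolynomial.isHomogeneous_monomial c rfl))
  | add p q hp hq => exact hadd p q _ (fun y => by simp [polyEval]) hp hq

end Convergence

/-- The Gegenbauer polynomials `C_k^{(N-1)/2}(t)`, through the three-term recurrence. -/
def gegR (N : ℕ) (t : ℝ) : ℕ → ℝ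
  | 0 => 1
  | 1 => (N - 1) * t
  | k + 2 => (2 * k + N + 1) / (k + 2) * (t * gegR N t (k + 1)) -
      (k + N - 1) / (k + 2) * gegR N t k

lemma polyEval_gegPoly {N : ℕ} (x y : Sph N) (k : ℕ) :
    polyEval (gegPoly (fun i => (y : Amb N) i) k) (x : Amb N) =
      gegR N ⟪(x : Amb N), (y : Amb N)⟫ k := by
  have h1 : polyEval (linForm fun i => (y : Amb N) i) (x : Amb N) = ⟪(x : Amb N), (y : Amb N)⟫ := by
    simp [polyEval, linForm, PiLp.inner_apply]
  have h2 : polyEval (normSqPoly N) (x : Amb N) = 1 := by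
    simpa [polyEval, normSqPoly] using sum_coe_sq x
  unfold polyEval at h1 h2 ⊢
  induction k using Nat.strong_induction_on with
  | _ k ih =>
  match k, ih with
  | 0, _ => simp [gegPoly, gegR]
  | 1, _ => simp [gegPoly, gegR, h1]
  | k + 2, ih =>
    simp only [gegPoly, gegR, map_sub, map_mul, MvPolynomial.eval_C, h1, h2, ih k (by omega),
      ih (k + 1) (by omega), one_mul]

section GeneratingFunction

open PowerSeries

/-- The power series of `(1 - e z)^{-a}`. -/
def negBinSeries (e a : ℂ) : PowerSeries ℂ := mk fun j => Ring.multichoose a j * e ^ j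

lemma multichoose_succ_mul (a : ℂ) (j : ℕ) :
    (j + 1) * Ring.multichoose a (j + 1) = (a + j) * Ring.multichoose a j := by
  have h1 := Ring.factorial_nsmul_multichoose_eq_ascPochhammer a (j + 1)
  have h2 := Ring.factorial_nsmul_multichoose_eq_ascPochhammer a j
  have h3 : ((j.factorial : ℕ) : ℂ) ≠ 0 := by exact_mod_cast j.factorial_ne_zero
  rw [Polynomial.ascPochhammer_smeval_eq_eval, nsmul_eq_mul] at h1 h2
  rw [ascPochhammer_succ_eval, ← h2, Nat.factorial_succ] at h1
  apply mul_left_cancel₀ h3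
  push_cast at h1
  linear_combination h1

lemma one_sub_mul_negBinSeries_add_one (e a : ℂ) :
    (1 - C e * X) * negBinSeries e (a + 1) = negBinSeries e a := by
  ext j
  rw [sub_mul, one_mul, mul_assoc, map_sub, coeff_C_mul]
  rcases j with _ | j
  · simp [negBinSeries]
  · rw [coeff_succ_X_mul]
    simp only [negBinSeries, coeff_mk, Ring.multichoose_succ_succ]
    ring

lemma one_sub_mul_derivative_negBinSeries (e a : ℂ) :
    (1 - C e * X) * d⁄dX ℂ (negBinSeries e a) = C (e * a) * negBinSeries e a := by
  ext j
  have h := multichoose_succ_mul a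
  rw [sub_mul, one_mul, mul_assoc, map_sub, coeff_C_mul, coeff_C_mul]
  rcases j with _ | j
  · have := h 0
    simp [negBinSeries, coeff_derivative, mul_comm]
  · rw [coeff_succ_X_mul]
    simp only [negBinSeries, coeff_mk, coeff_derivative]
    have h1 := h (j + 1)
    push_cast at h1 ⊢
    linear_combination e ^ (j + 2) * h1

/-- The generating series of the Gegenbauer polynomials of index `l` at `(e + e') / 2`, where
`e * e' = 1`. -/
def gegSeries (e e' l : ℂ) : PowerSeries ℂ := negBinSeries e l * negBinSeries e' l

lemma mul_derivative_gegSeries {e e' : ℂ} (he : e * e' = 1) (l : ℂ) :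
    (1 - C (e + e') * X + X ^ 2) * d⁄dX ℂ (gegSeries e e' l) =
      C l * (C (e + e') - 2 * X) * gegSeries e e' l := by
  have h1 := one_sub_mul_derivative_negBinSeries e l
  have h2 := one_sub_mul_derivative_negBinSeries e' l
  have h3 : (C e * C e' : PowerSeries ℂ) = 1 := by rw [← map_mul, he, map_one]
  simp only [map_mul] at h1 h2
  rw [gegSeries, Derivation.leibniz, smul_eq_mul, smul_eq_mul, map_add]
  linear_combination (1 - C e' * X) * negBinSeries e' l * h1 +
    (1 - C e * X) * negBinSeries e l * h2 -
    (X ^ 2 * (negBinSeries e l * d⁄dX ℂ (negBinSeries e' l) +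
      negBinSeries e' l * d⁄dX ℂ (negBinSeries e l)) +
        2 * C l * X * (negBinSeries e l * negBinSeries e' l)) * h3

lemma mul_gegSeries_add_one {e e' : ℂ} (he : e * e' = 1) (l : ℂ) :
    (1 - C (e + e') * X + X ^ 2) * gegSeries e e' (l + 1) = gegSeries e e' l := by
  have h1 := one_sub_mul_negBinSeries_add_one e l
  have h2 := one_sub_mul_negBinSeries_add_one e' l
  have h3 : (C e * C e' : PowerSeries ℂ) = 1 := by rw [← map_mul, he, map_one]
  rw [gegSeries, gegSeries, ← h1, ← h2, map_add]
  linear_combination -X ^ 2 * negBinSeries e (l + 1) * negBinSeries e' (l + 1) * h3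

lemma mul_gegSeries_add_X_mul_derivative {e e' : ℂ} (he : e * e' = 1) (l : ℂ) :
    C l * gegSeries e e' l + X * d⁄dX ℂ (gegSeries e e' l) =
      C l * (1 - X ^ 2) * gegSeries e e' (l + 1) := by
  have hD : (1 - C (e + e') * X + X ^ 2 : PowerSeries ℂ) ≠ 0 := by
    intro h
    have := congrArg constantCoeff h
    simp at this
  apply mul_left_cancel₀ hD
  linear_combination X * mul_derivative_gegSeries he l -
    C l * (1 - X ^ 2) * mul_gegSeries_add_one he l

lemma coeff_gegSeries {N : ℕ} {t : ℝ} {e e' : ℂ} (he : e * e' = 1) (het : e + e' = 2 * t)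
    (k : ℕ) : coeff k (gegSeries e e' ((N - 1) / 2)) = gegR N t k := by
  have hc0 : coeff 0 (gegSeries e e' ((N - 1) / 2)) = 1 := by
    simp [gegSeries, negBinSeries]
  have hD := mul_derivative_gegSeries he ((N - 1) / 2)
  set G := gegSeries e e' ((N - 1) / 2)
  rw [add_mul, sub_mul, one_mul, mul_assoc, mul_assoc, sub_mul, het] at hD
  have hrec (k : ℕ) : coeff (k + 2) G * (k + 2) - 2 * t * (coeff (k + 1) G * (k + 1)) +
      coeff k G * k = (N - 1) / 2 * (2 * t * coeff (k + 1) G - 2 * coeff k G) := by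
    have h := congrArg (coeff (k + 1)) hD
    have h2 : coeff (k + 1) (X ^ 2 * d⁄dX ℂ G) = coeff k G * k := by
      rcases k with _ | k
      · rw [coeff_X_pow_mul']; simp
      · rw [coeff_X_pow_mul']
        simp [coeff_derivative]
    rw [map_add, map_sub, h2, coeff_C_mul, coeff_C_mul, map_sub, coeff_C_mul, coeff_succ_X_mul,
      mul_assoc 2 X G, ← map_ofNat (C : ℂ →+* PowerSeries ℂ) 2, coeff_C_mul, coeff_succ_X_mul,
      coeff_derivative, coeff_derivative] at h
    push_cast at h
    linear_combination h
  have hrec0 : coeff 1 G = (N - 1) * t := by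
    have h := congrArg (coeff 0) hD
    rw [coeff_zero_eq_constantCoeff_apply] at hc0
    have hc1 : constantCoeff (d⁄dX ℂ G) = coeff 1 G := by
      rw [← coeff_zero_eq_constantCoeff_apply, coeff_derivative]; simp
    simp [hc0, hc1] at h
    linear_combination h
  induction k using Nat.strong_induction_on with
  | _ k ih =>
  match k, ih with
  | 0, _ => simp [hc0, gegR]
  | 1, _ => simp [hrec0, gegR]
  | k + 2, ih =>
    have h := hrec k
    rw [ih k (by omega), ih (k + 1) (by omega)] at h
    have h3 : (k + 2 : ℂ) ≠ 0 := by exact_mod_cast (show k + 2 ≠ 0 by omega)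
    rw [gegR]
    push_cast
    field_simp
    linear_combination h

lemma coeff_mul_gegSeries {N : ℕ} {t : ℝ} {e e' : ℂ} (he : e * e' = 1) (het : e + e' = 2 * t)
    (n : ℕ) :
    ∑ k ∈ Finset.range (n + 1), Ring.multichoose ((N - 1) / 2 + 1 : ℂ) (n - k) *
        (((2 * k + N - 1) * gegR N t k : ℝ) : ℂ) =
      (N - 1) * coeff n ((1 + X) * negBinSeries 1 ((N - 1) / 2) *
        gegSeries e e' ((N - 1) / 2 + 1)) := by
  have h1 := mul_gegSeries_add_X_mul_derivative he ((N - 1) / 2)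
  have h2 := one_sub_mul_negBinSeries_add_one 1 ((N - 1) / 2)
  rw [map_one, one_mul] at h2
  have h3 : C (N - 1 : ℂ) * ((1 + X) * negBinSeries 1 ((N - 1) / 2) *
        gegSeries e e' ((N - 1) / 2 + 1)) = (C 2 * (C ((N - 1) / 2 : ℂ) *
        gegSeries e e' ((N - 1) / 2) + X * d⁄dX ℂ (gegSeries e e' ((N - 1) / 2)))) *
          negBinSeries 1 ((N - 1) / 2 + 1) := by
    have h5 : (C (N - 1 : ℂ) : PowerSeries ℂ) = C 2 * C ((N - 1) / 2 : ℂ) := by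
      rw [← map_mul, mul_div_cancel₀ _ two_ne_zero]
    rw [h1, ← h2, h5]
    ring
  rw [← coeff_C_mul, h3, coeff_mul, Finset.Nat.sum_antidiagonal_eq_sum_range_succ_mk]
  refine Finset.sum_congr rfl fun k _ => ?_
  have h4 : coeff (R := ℂ) k (X * d⁄dX ℂ (gegSeries e e' ((N - 1) / 2))) = k * gegR N t k := by
    rcases k with _ | k
    · simp
    · rw [coeff_succ_X_mul, coeff_derivative, coeff_gegSeries he het]
      push_cast; ring
  dsimp only
  rw [coeff_C_mul, map_add, coeff_C_mul, h4, coeff_gegSeries he het, negBinSeries, coeff_mk]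
  push_cast
  ring

lemma ofReal_cesaroA {α : ℝ} (hα : 0 ≤ α) (m : ℕ) :
    (cesaroA α m : ℂ) = Ring.multichoose (α + 1 : ℂ) m := by
  induction m with
  | zero =>
    have := (Real.Gamma_pos_of_pos (show 0 < α + 1 by positivity)).ne'
    simp [cesaroA, this]
  | succ m ih =>
    have h1 := multichoose_succ_mul (α + 1) m
    have h2 : ((m + 1 : ℝ) * cesaroA α (m + 1) : ℂ) = (α + m + 1 : ℝ) * cesaroA α m := by
      exact_mod_cast cesaroA_succ hα m
    have h3 : (m + 1 : ℂ) ≠ 0 := by exact_mod_cast m.succ_ne_zero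
    rw [ih] at h2
    apply mul_left_cancel₀ h3
    push_cast at h2
    linear_combination h2 - h1

end GeneratingFunction

section Evaluation

open PowerSeries

/-- The power series `Q` converges absolutely at `z`, with sum `w`. -/
def AbsEvals (Q : PowerSeries ℂ) (z w : ℂ) : Prop :=
  Summable (fun n => ‖coeff n Q * z ^ n‖) ∧ ∑' n, coeff n Q * z ^ n = w

lemma AbsEvals.mul {P Q : PowerSeries ℂ} {z v w : ℂ} (hP : AbsEvals P z v)
    (hQ : AbsEvals Q z w) : AbsEvals (P * Q) z (v * w) := by
  have hs := summable_norm_sum_mul_antidiagonal_of_summable_norm hP.1 hQ.1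
  have ht := tsum_mul_tsum_eq_tsum_sum_antidiagonal_of_summable_norm hP.1 hQ.1
  rw [hP.2, hQ.2] at ht
  have h (n : ℕ) : coeff n (P * Q) * z ^ n = ∑ kl ∈ Finset.HasAntidiagonal.antidiagonal n,
      (coeff kl.1 P * z ^ kl.1) * (coeff kl.2 Q * z ^ kl.2) := by
    rw [coeff_mul, Finset.sum_mul]
    refine Finset.sum_congr rfl fun kl hkl => ?_
    rw [← Finset.HasAntidiagonal.mem_antidiagonal.1 hkl, pow_add]
    ring
  exact ⟨hs.congr fun n => by rw [h], by rw [ht]; exact tsum_congr h⟩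

lemma absEvals_one_add_X (z : ℂ) : AbsEvals (1 + X) z (1 + z) := by
  have h : ∀ n ∉ Finset.range 2, coeff n (1 + X : PowerSeries ℂ) * z ^ n = 0 := by
    intro n hn
    have hn2 : 1 < n := by simpa using hn
    rw [map_add, coeff_one, coeff_X, if_neg (by omega), if_neg (by omega)]
    simp
  constructor
  · exact summable_of_ne_finset_zero (s := Finset.range 2) fun n hn => by rw [h n hn, norm_zero]
  · rw [tsum_eq_sum h]
    simp [Finset.sum_range_succ, coeff_one, coeff_X]

lemma absEvals_negBinSeries {e z : ℂ} (h : ‖e * z‖ < 1) (a : ℂ) :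
    AbsEvals (negBinSeries e a) z (1 / (1 - e * z) ^ a) := by
  have hb := Complex.one_div_one_sub_cpow_hasFPowerSeriesOnBall_zero a
  have hmem : e * z ∈ Metric.eball (0 : ℂ) 1 := by
    simpa [Metric.mem_eball, edist_zero_right, enorm_eq_nnnorm, ← NNReal.coe_lt_one, -norm_mul,
      -nnnorm_mul] using h
  have hterm (n : ℕ) : (FormalMultilinearSeries.ofScalars ℂ
      fun n : ℕ => Ring.choose (a + n - 1) n) n (fun _ => e * z) =
      coeff n (negBinSeries e a) * z ^ n := by
    rw [negBinSeries, coeff_mk, Ring.multichoose_eq]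
    simp [FormalMultilinearSeries.ofScalars, mul_pow, mul_assoc]
  constructor
  · refine (FormalMultilinearSeries.summable_norm_apply _
      (Metric.eball_subset_eball hb.r_le hmem)).congr fun n => ?_
    rw [hterm]
  · have := (hb.hasSum hmem).tsum_eq
    simp only [hterm, zero_add] at this
    exact this

lemma norm_coeff_le_of_absEvals {Q : PowerSeries ℂ} {F : ℂ → ℂ}
    (h : ∀ z, ‖z‖ < 1 → AbsEvals Q z (F z)) {ρ : ℝ} (hρ0 : 0 < ρ) (hρ1 : ρ < 1) (n : ℕ) :
    ‖coeff n Q‖ ≤ ((2 * π)⁻¹ * ∫ θ in 0..2 * π, ‖F (circleMap 0 ρ θ)‖) * (ρ ^ n)⁻¹ := by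
  have hF : HasFPowerSeriesOnBall F (FormalMultilinearSeries.ofScalars ℂ fun n => coeff n Q)
      0 1 := by
    refine ⟨?_, one_pos, fun {y} hy => ?_⟩
    · refine ENNReal.le_of_forall_nnreal_lt fun r hr => ?_
      have hr1 : (r : ℝ) < 1 := by exact_mod_cast hr
      refine FormalMultilinearSeries.le_radius_of_summable _
        (((h (r : ℂ) (by simpa using hr1)).1).congr fun n => ?_)
      simp
    · have hy1 : ‖y‖ < 1 := by
        simpa [Metric.mem_eball, edist_zero_right, enorm_eq_nnnorm, ← NNReal.coe_lt_one] using hy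
      obtain ⟨hs, ht⟩ := h y hy1
      rw [zero_add, ← ht]
      convert hs.of_norm.hasSum using 2 with n
      simp [FormalMultilinearSeries.ofScalars]
  lift ρ to ℝ≥0 using hρ0.le
  have hd : DifferentiableOn ℂ F (closedBall 0 ρ) := by
    refine hF.differentiableOn.mono fun z hz => ?_
    have : ‖z‖ < 1 := (mem_closedBall_zero_iff.1 hz).trans_lt hρ1
    simpa [Metric.mem_eball, edist_zero_right, enorm_eq_nnnorm, ← NNReal.coe_lt_one] using this
  have hc := hd.hasFPowerSeriesOnBall (by exact_mod_cast hρ0)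
  have heq := hF.hasFPowerSeriesAt.eq_formalMultilinearSeries hc.hasFPowerSeriesAt
  have hn := norm_cauchyPowerSeries_le F 0 ρ n
  rw [← heq, FormalMultilinearSeries.ofScalars_norm, abs_of_nonneg hρ0.le, inv_pow] at hn
  exact hn

/-- The generating function of the Cesàro kernels. -/
def kernelGenFun (e e' : ℂ) (l : ℝ) (z : ℂ) : ℂ :=
  (1 + z) * (1 / (1 - z) ^ (l : ℂ)) *
    (1 / (1 - e * z) ^ ((l + 1 : ℝ) : ℂ) * (1 / (1 - e' * z) ^ ((l + 1 : ℝ) : ℂ)))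

lemma absEvals_kernelGenFun {e e' z : ℂ} (he : ‖e‖ = 1) (he' : ‖e'‖ = 1) (l : ℝ) (hz : ‖z‖ < 1) :
    AbsEvals ((1 + X) * negBinSeries 1 l * gegSeries e e' (l + 1)) z (kernelGenFun e e' l z) := by
  have h1 := absEvals_negBinSeries (e := 1) (z := z) (by simpa using hz) l
  have h2 := absEvals_negBinSeries (e := e) (z := z) (by simpa [he] using hz) (l + 1)
  have h3 := absEvals_negBinSeries (e := e') (z := z) (by simpa [he'] using hz) (l + 1)
  have := ((absEvals_one_add_X z).mul h1).mul (h2.mul h3)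
  simpa [kernelGenFun, gegSeries] using this

lemma norm_kernelGenFun (e e' : ℂ) (l : ℝ) (z : ℂ) :
    ‖kernelGenFun e e' l z‖ = ‖1 + z‖ * (‖1 - z‖ ^ l)⁻¹ *
      ((‖1 - e * z‖ ^ (l + 1))⁻¹ * (‖1 - e' * z‖ ^ (l + 1))⁻¹) := by
  simp only [kernelGenFun, norm_mul, norm_inv, Complex.norm_cpow_real, one_div]

end Evaluation

section KernelEstimate

lemma mul_inv_rpow_le {l s q u v A B : ℝ} (hl : 0 < l) (hq : 0 < q) (hu : 0 < u)
    (hv : 0 < v) (hA : 0 < A) (hB : 0 < B) (h1 : A * s ≤ u + v) (h2 : A * B ≤ u + v)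
    (h3 : A ≤ q + u) (h4 : A ≤ q + v) :
    s * (q ^ l)⁻¹ * ((u ^ (l + 1))⁻¹ * (v ^ (l + 1))⁻¹) ≤
      2 / A * ((A * B / 2) ^ l)⁻¹ * ((A / 2) ^ l)⁻¹ *
        ((q ^ (l + 1))⁻¹ + (u ^ (l + 1))⁻¹ + (v ^ (l + 1))⁻¹) := by
  wlog huv : u ≤ v generalizing u v
  · have := this hv hu (by linarith) (by linarith) h4 h3 (by linarith)
    rw [mul_comm (u ^ (l + 1))⁻¹, add_assoc, add_comm (u ^ (l + 1))⁻¹, ← add_assoc]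
    exact this
  have hsv : s * (v ^ (l + 1))⁻¹ ≤ 2 / A * ((A * B / 2) ^ l)⁻¹ := by
    have hs' : s ≤ 2 / A * v := by
      rw [div_mul_eq_mul_div, le_div_iff₀ hA]; linarith
    have hv' : ((v ^ l))⁻¹ ≤ ((A * B / 2) ^ l)⁻¹ := by
      refine inv_anti₀ (by positivity) (Real.rpow_le_rpow (by positivity) (by linarith) hl.le)
    calc s * (v ^ (l + 1))⁻¹ ≤ 2 / A * v * (v ^ (l + 1))⁻¹ := by gcongr
      _ = 2 / A * (v ^ l)⁻¹ := by
        rw [Real.rpow_add_one hv.ne']; field_simp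
      _ ≤ _ := by gcongr
  have hqu : (q ^ l)⁻¹ * (u ^ (l + 1))⁻¹ ≤ ((A / 2) ^ l)⁻¹ *
      ((q ^ (l + 1))⁻¹ + (u ^ (l + 1))⁻¹ + (v ^ (l + 1))⁻¹) := by
    rcases le_total u q with h | h
    · have : (q ^ l)⁻¹ ≤ ((A / 2) ^ l)⁻¹ :=
        inv_anti₀ (by positivity) (Real.rpow_le_rpow (by positivity) (by linarith) hl.le)
      gcongr
      have := Real.rpow_nonneg hq.le (l + 1)
      have := Real.rpow_nonneg hv.le (l + 1)
      have := inv_nonneg.2 this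
      have : 0 ≤ (q ^ (l + 1))⁻¹ := by positivity
      linarith
    · have h5 : (u ^ l)⁻¹ ≤ ((A / 2) ^ l)⁻¹ :=
        inv_anti₀ (by positivity) (Real.rpow_le_rpow (by positivity) (by linarith) hl.le)
      have h6 : u⁻¹ ≤ q⁻¹ := inv_anti₀ hq h
      calc (q ^ l)⁻¹ * (u ^ (l + 1))⁻¹ = (u ^ l)⁻¹ * ((q ^ l)⁻¹ * u⁻¹) := by
            rw [Real.rpow_add_one hu.ne', mul_inv]; ring
        _ ≤ ((A / 2) ^ l)⁻¹ * ((q ^ l)⁻¹ * q⁻¹) := by gcongr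
        _ = ((A / 2) ^ l)⁻¹ * (q ^ (l + 1))⁻¹ := by
            rw [Real.rpow_add_one hq.ne', mul_inv]
        _ ≤ _ := by
            gcongr
            have : 0 ≤ (u ^ (l + 1))⁻¹ := by positivity
            have : 0 ≤ (v ^ (l + 1))⁻¹ := by positivity
            linarith
  calc s * (q ^ l)⁻¹ * ((u ^ (l + 1))⁻¹ * (v ^ (l + 1))⁻¹)
      = (s * (v ^ (l + 1))⁻¹) * ((q ^ l)⁻¹ * (u ^ (l + 1))⁻¹) := by ring
    _ ≤ (2 / A * ((A * B / 2) ^ l)⁻¹) * (((A / 2) ^ l)⁻¹ *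
      ((q ^ (l + 1))⁻¹ + (u ^ (l + 1))⁻¹ + (v ^ (l + 1))⁻¹)) := by gcongr
    _ = _ := by ring

lemma le_norm_one_sub_circleMap {ρ θ : ℝ} (hρ : 1 / 2 ≤ ρ) (hρ1 : ρ < 1) (hθ : |θ| ≤ π) :
    (1 - ρ + |θ|) / 4 ≤ ‖1 - circleMap 0 ρ θ‖ := by
  have hc := Real.cos_le_one_sub_mul_cos_sq hθ
  have hn : ‖1 - circleMap 0 ρ θ‖ ^ 2 = (1 - ρ) ^ 2 + 2 * ρ * (1 - cos θ) := by
    rw [← Complex.normSq_eq_norm_sq, Complex.normSq_apply]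
    have hre : (1 - circleMap 0 ρ θ).re = 1 - ρ * cos θ := by
      simp [circleMap, Complex.exp_ofReal_mul_I_re]
    have him : (1 - circleMap 0 ρ θ).im = - (ρ * sin θ) := by
      simp [circleMap, Complex.exp_ofReal_mul_I_im]
    rw [hre, him]
    linear_combination ρ ^ 2 * Real.sin_sq_add_cos_sq θ
  refine le_of_sq_le_sq ?_ (norm_nonneg _)
  rw [hn]
  have h5 : 1 / 5 ≤ 2 / π ^ 2 := by
    rw [div_le_div_iff₀ (by norm_num) (by positivity)]
    nlinarith [Real.pi_lt_d2, Real.pi_pos]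
  have h6 : 1 / 5 * θ ^ 2 ≤ 1 - cos θ := by nlinarith [sq_nonneg θ]
  have h7 : 1 - cos θ ≤ 2 * ρ * (1 - cos θ) := by nlinarith [Real.cos_le_one θ]
  nlinarith [sq_nonneg (1 - ρ - |θ|), sq_abs θ]

lemma integral_inv_rpow_le {l d : ℝ} (hl : 0 < l) (hd : 0 < d) :
    ∫ θ in (0 : ℝ)..π, ((d + θ) ^ (l + 1))⁻¹ ≤ l⁻¹ * (d ^ l)⁻¹ := by
  have h1 : ∫ θ in (0 : ℝ)..π, ((d + θ) ^ (l + 1))⁻¹ = ∫ x in d..(d + π), x ^ (-(l + 1)) := by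
    rw [intervalIntegral.integral_comp_add_left (fun x => (x ^ (l + 1))⁻¹), add_zero]
    refine intervalIntegral.integral_congr fun x hx => ?_
    rw [Set.uIcc_of_le (by linarith [Real.pi_pos])] at hx
    exact (Real.rpow_neg (hd.le.trans hx.1) _).symm
  rw [h1, integral_rpow]
  · rw [show -(l + 1) + 1 = -l by ring, Real.rpow_neg hd.le, Real.rpow_neg (by positivity),
      div_neg, ← neg_div, neg_sub, div_eq_inv_mul]
    gcongr
    have : 0 ≤ ((d + π) ^ l)⁻¹ := by positivity
    linarith
  · right
    refine ⟨by linarith, ?_⟩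
    rw [Set.uIcc_of_le (by linarith [Real.pi_pos])]
    exact fun h => absurd h.1 (by linarith)

lemma one_sub_mul_circleMap_ne_zero {e : ℂ} (he : ‖e‖ = 1) {ρ : ℝ} (hρ : 0 ≤ ρ) (hρ1 : ρ < 1)
    (θ : ℝ) : 0 < ‖1 - e * circleMap 0 ρ θ‖ := by
  have h : ‖e * circleMap 0 ρ θ‖ = ρ := by
    rw [norm_mul, he, norm_circleMap_zero, abs_of_nonneg hρ, one_mul]
  have := norm_sub_norm_le 1 (e * circleMap 0 ρ θ)
  rw [h, norm_one] at this
  linarith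

lemma continuous_inv_norm_one_sub_rpow {e : ℂ} (he : ‖e‖ = 1) {ρ : ℝ} (hρ : 0 ≤ ρ)
    (hρ1 : ρ < 1) (p : ℝ) : Continuous fun θ : ℝ => (‖1 - e * circleMap 0 ρ θ‖ ^ p)⁻¹ := by
  have hc : Continuous fun θ : ℝ => ‖1 - e * circleMap 0 ρ θ‖ := by fun_prop
  have hpos := one_sub_mul_circleMap_ne_zero he hρ hρ1
  exact (hc.rpow_const fun θ => Or.inl (hpos θ).ne').inv₀
    fun θ => (Real.rpow_pos_of_pos (hpos θ) _).ne'

lemma integral_inv_norm_one_sub_rpow_le {l ρ : ℝ} (hl : 0 < l) (hρ : 1 / 2 ≤ ρ) (hρ1 : ρ < 1)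
    {e : ℂ} (he : ‖e‖ = 1) :
    ∫ θ in 0..2 * π, (‖1 - e * circleMap 0 ρ θ‖ ^ (l + 1))⁻¹ ≤
      2 * 4 ^ (l + 1) * l⁻¹ * ((1 - ρ) ^ l)⁻¹ := by
  have hd : 0 < 1 - ρ := by linarith
  have hρ0 : 0 ≤ ρ := by linarith
  set g : ℝ → ℝ := fun θ => (‖1 - circleMap 0 ρ θ‖ ^ (l + 1))⁻¹ with hg
  have hgc : Continuous g := by
    simpa using continuous_inv_norm_one_sub_rpow (e := 1) norm_one hρ0 hρ1 (l + 1)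
  have hgp : Function.Periodic g (2 * π) := fun θ => by
    simp only [hg, periodic_circleMap 0 ρ θ]
  have hshift (θ : ℝ) : (‖1 - e * circleMap 0 ρ θ‖ ^ (l + 1))⁻¹ = g (θ + e.arg) := by
    have : e * circleMap 0 ρ θ = circleMap 0 ρ (θ + e.arg) := by
      conv_lhs => rw [← Complex.norm_mul_exp_arg_mul_I e, he]
      simp only [circleMap, zero_add, Complex.ofReal_one, one_mul, Complex.ofReal_add, add_mul,
        Complex.exp_add]
      ring
    rw [this]
  have hbound (θ : ℝ) (hθ : |θ| ≤ π) : g θ ≤ 4 ^ (l + 1) * ((1 - ρ + |θ|) ^ (l + 1))⁻¹ := by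
    have h := le_norm_one_sub_circleMap hρ hρ1 hθ
    have h0 : 0 < 1 - ρ + |θ| := by positivity
    calc g θ ≤ (((1 - ρ + |θ|) / 4) ^ (l + 1))⁻¹ :=
          inv_anti₀ (by positivity) (Real.rpow_le_rpow (by positivity) h (by linarith))
      _ = _ := by rw [Real.div_rpow h0.le (by norm_num), inv_div, div_eq_mul_inv]
  have hI := integral_inv_rpow_le hl hd
  have hcont : Continuous fun θ : ℝ => 4 ^ (l + 1) * ((1 - ρ + |θ|) ^ (l + 1))⁻¹ := by
    have hpos (θ : ℝ) : 0 < 1 - ρ + |θ| := by positivity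
    exact continuous_const.mul (((by fun_prop : Continuous fun θ : ℝ => 1 - ρ + |θ|).rpow_const
      fun θ => Or.inl (hpos θ).ne').inv₀ fun θ => (Real.rpow_pos_of_pos (hpos θ) _).ne')
  have hhalf : ∫ θ in (0 : ℝ)..π, 4 ^ (l + 1) * ((1 - ρ + |θ|) ^ (l + 1))⁻¹ ≤
      4 ^ (l + 1) * (l⁻¹ * ((1 - ρ) ^ l)⁻¹) := by
    rw [intervalIntegral.integral_const_mul]
    gcongr
    refine (intervalIntegral.integral_congr fun θ hθ => ?_).trans_le hI
    rw [Set.uIcc_of_le Real.pi_pos.le] at hθ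
    simp only [abs_of_nonneg hθ.1]
  have hhalf' : ∫ θ in (-π)..(0 : ℝ), 4 ^ (l + 1) * ((1 - ρ + |θ|) ^ (l + 1))⁻¹ ≤
      4 ^ (l + 1) * (l⁻¹ * ((1 - ρ) ^ l)⁻¹) := by
    refine le_trans (le_of_eq ?_) hhalf
    rw [← neg_zero, ← intervalIntegral.integral_comp_neg]
    simp
  calc ∫ θ in 0..2 * π, (‖1 - e * circleMap 0 ρ θ‖ ^ (l + 1))⁻¹
      = ∫ θ in 0..2 * π, g (θ + e.arg) := by simp only [hshift]
    _ = ∫ θ in e.arg..(e.arg + 2 * π), g θ := by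
        rw [intervalIntegral.integral_comp_add_right, zero_add, add_comm]
    _ = ∫ θ in (-π)..(-π + 2 * π), g θ := hgp.intervalIntegral_add_eq _ _
    _ ≤ ∫ θ in (-π)..(-π + 2 * π), 4 ^ (l + 1) * ((1 - ρ + |θ|) ^ (l + 1))⁻¹ := by
        refine intervalIntegral.integral_mono_on (by linarith [Real.pi_pos])
          (hgc.intervalIntegrable _ _) (hcont.intervalIntegrable _ _) fun θ hθ => hbound θ ?_
        exact abs_le.2 ⟨hθ.1, hθ.2.trans (by linarith)⟩
    _ = (∫ θ in (-π)..(0 : ℝ), 4 ^ (l + 1) * ((1 - ρ + |θ|) ^ (l + 1))⁻¹) +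
          ∫ θ in (0 : ℝ)..π, 4 ^ (l + 1) * ((1 - ρ + |θ|) ^ (l + 1))⁻¹ := by
        rw [show -π + 2 * π = π by ring, intervalIntegral.integral_add_adjacent_intervals
          (hcont.intervalIntegrable _ _) (hcont.intervalIntegrable _ _)]
    _ ≤ 2 * 4 ^ (l + 1) * l⁻¹ * ((1 - ρ) ^ l)⁻¹ := by linarith

lemma norm_kernelGenFun_le {l : ℝ} (hl : 0 < l) {e z : ℂ} (he : ‖e‖ = 1)
    (hA : 0 < ‖1 - e‖) (hB : 0 < ‖1 + e‖) (hz : ‖z‖ < 1) :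
    ‖kernelGenFun e (starRingEnd ℂ e) l z‖ ≤
      2 / ‖1 - e‖ * ((‖1 - e‖ * ‖1 + e‖ / 2) ^ l)⁻¹ * ((‖1 - e‖ / 2) ^ l)⁻¹ *
        ((‖1 - 1 * z‖ ^ (l + 1))⁻¹ + (‖1 - e * z‖ ^ (l + 1))⁻¹ +
          (‖1 - starRingEnd ℂ e * z‖ ^ (l + 1))⁻¹) := by
  set e' := starRingEnd ℂ e with he'
  have hee : e * e' = 1 := by rw [he', Complex.mul_conj, Complex.normSq_eq_norm_sq, he]; norm_num
  have hne' : ‖e'‖ = 1 := by rw [he', Complex.norm_conj, he]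
  have hA' : ‖1 - e'‖ = ‖1 - e‖ := by rw [he', ← Complex.norm_conj (1 - e)]; simp
  have hB' : ‖1 + e'‖ = ‖1 + e‖ := by rw [he', ← Complex.norm_conj (1 + e)]; simp
  have hAB : ‖e - e'‖ = ‖1 - e‖ * ‖1 + e‖ := by
    have : (e - e') * e = -((1 - e) * (1 + e)) := by linear_combination -hee
    rw [← norm_mul, ← norm_neg ((1 - e) * (1 + e)), ← this, norm_mul, he, mul_one]
  have hpos {w : ℂ} (hw : ‖w‖ = 1) : 0 < ‖1 - w * z‖ := by
    have := norm_sub_norm_le 1 (w * z)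
    rw [norm_mul, hw, norm_one] at this
    linarith
  rw [norm_kernelGenFun, one_mul]
  refine mul_inv_rpow_le hl (by simpa using hpos norm_one) (hpos he) (hpos hne')
    hA hB ?_ ?_ ?_ ?_
  · refine le_of_mul_le_mul_left ?_ hB
    have h : (e - e') * (1 + z) = (1 + e) * (1 - e' * z) - (1 + e') * (1 - e * z) := by
      linear_combination (-2 * z) * hee * 0
    calc ‖1 + e‖ * (‖1 - e‖ * ‖1 + z‖) = ‖(e - e') * (1 + z)‖ := by
          rw [norm_mul, hAB]; ring
      _ ≤ ‖1 + e‖ * ‖1 - e' * z‖ + ‖1 + e'‖ * ‖1 - e * z‖ := by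
          rw [h, ← norm_mul, ← norm_mul]; exact norm_sub_le _ _
      _ = _ := by rw [hB']; ring
  · have h : e - e' = e * (1 - e' * z) - e' * (1 - e * z) := by ring
    rw [← hAB, h]
    refine (norm_sub_le _ _).trans_eq ?_
    rw [norm_mul, norm_mul, he, hne']; ring
  · have h : 1 - e' = (1 - z) - e' * (1 - e * z) := by linear_combination (-z) * hee
    rw [← hA', h]
    refine (norm_sub_le _ _).trans_eq ?_
    rw [norm_mul, hne', one_mul]
  · have h : 1 - e = (1 - z) - e * (1 - e' * z) := by linear_combination (-z) * hee
    rw [h]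
    refine (norm_sub_le _ _).trans_eq ?_
    rw [norm_mul, he, one_mul]

lemma norm_coeff_kernel_le {l : ℝ} (hl : 0 < l) {e : ℂ} (he : ‖e‖ = 1)
    (hA : 0 < ‖1 - e‖) (hB : 0 < ‖1 + e‖) (n : ℕ) :
    ‖PowerSeries.coeff n ((1 + PowerSeries.X) * negBinSeries 1 l *
        gegSeries e (starRingEnd ℂ e) (l + 1))‖ ≤
      (2 / ‖1 - e‖ * ((‖1 - e‖ * ‖1 + e‖ / 2) ^ l)⁻¹ * ((‖1 - e‖ / 2) ^ l)⁻¹) *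
        (3 * 4 ^ (l + 1) * l⁻¹ * rexp 1 * (n + 2) ^ l) := by
  set ρ : ℝ := (n + 1) / (n + 2) with hρ
  have hn : (0 : ℝ) ≤ n := n.cast_nonneg
  have hρ2 : 1 / 2 ≤ ρ := by rw [hρ, div_le_div_iff₀ (by norm_num) (by positivity)]; linarith
  have hρ1 : ρ < 1 := by rw [hρ, div_lt_one (by positivity)]; linarith
  have hρ0 : 0 < ρ := by linarith
  have h1ρ : 1 - ρ = (n + 2 : ℝ)⁻¹ := by rw [hρ]; field_simp; ring
  have hne' : ‖starRingEnd ℂ e‖ = 1 := by rw [Complex.norm_conj, he]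
  set K : ℝ := 2 / ‖1 - e‖ * ((‖1 - e‖ * ‖1 + e‖ / 2) ^ l)⁻¹ * ((‖1 - e‖ / 2) ^ l)⁻¹ with hK
  have hK0 : 0 ≤ K := by positivity
  have hpow : (ρ ^ n)⁻¹ ≤ rexp 1 := by
    have h1 : ρ⁻¹ ≤ rexp ((n + 1 : ℝ)⁻¹) := by
      refine le_trans (le_of_eq ?_) (Real.add_one_le_exp _)
      rw [hρ]; field_simp; ring
    calc (ρ ^ n)⁻¹ = (ρ⁻¹) ^ n := (inv_pow _ _).symm
      _ ≤ (rexp ((n + 1 : ℝ)⁻¹)) ^ n := by gcongr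
      _ = rexp (n * (n + 1 : ℝ)⁻¹) := (Real.exp_nat_mul _ _).symm
      _ ≤ rexp 1 := by
        refine Real.exp_le_exp.2 ?_
        rw [← div_eq_mul_inv, div_le_one (by positivity)]; linarith
  have hcont {w : ℂ} (hw : ‖w‖ = 1) := (continuous_inv_norm_one_sub_rpow hw hρ0.le hρ1
    (l + 1)).intervalIntegrable (μ := volume) 0 (2 * π)
  have h_int : ∫ θ in 0..2 * π, ‖kernelGenFun e (starRingEnd ℂ e) l (circleMap 0 ρ θ)‖ ≤
      K * (3 * (2 * 4 ^ (l + 1) * l⁻¹ * ((1 - ρ) ^ l)⁻¹)) := by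
    have hz (θ : ℝ) : ‖circleMap 0 ρ θ‖ < 1 := by
      rwa [norm_circleMap_zero, abs_of_pos hρ0]
    calc _ ≤ ∫ θ in 0..2 * π, K * ((‖1 - 1 * circleMap 0 ρ θ‖ ^ (l + 1))⁻¹ +
            (‖1 - e * circleMap 0 ρ θ‖ ^ (l + 1))⁻¹ +
            (‖1 - starRingEnd ℂ e * circleMap 0 ρ θ‖ ^ (l + 1))⁻¹) := by
          refine intervalIntegral.integral_mono_on_of_le_Ioo (by positivity) ?_
            ((((hcont norm_one).add (hcont he)).add (hcont hne')).const_mul K)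
            fun θ _ => norm_kernelGenFun_le hl he hA hB (hz θ)
          simp only [norm_kernelGenFun]
          have hc1 := continuous_inv_norm_one_sub_rpow (e := 1) norm_one hρ0.le hρ1 l
          have hc2 := continuous_inv_norm_one_sub_rpow he hρ0.le hρ1 (l + 1)
          have hc3 := continuous_inv_norm_one_sub_rpow hne' hρ0.le hρ1 (l + 1)
          simp only [one_mul] at hc1
          exact ((Continuous.mul (by fun_prop) hc1).mul (hc2.mul hc3)).intervalIntegrable _ _
      _ = K * ((∫ θ in 0..2 * π, (‖1 - 1 * circleMap 0 ρ θ‖ ^ (l + 1))⁻¹) +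
            (∫ θ in 0..2 * π, (‖1 - e * circleMap 0 ρ θ‖ ^ (l + 1))⁻¹) +
            ∫ θ in 0..2 * π, (‖1 - starRingEnd ℂ e * circleMap 0 ρ θ‖ ^ (l + 1))⁻¹) := by
          rw [intervalIntegral.integral_const_mul, intervalIntegral.integral_add
            ((hcont norm_one).add (hcont he)) (hcont hne'),
            intervalIntegral.integral_add (hcont norm_one) (hcont he)]
      _ ≤ _ := by
          gcongr
          linarith [integral_inv_norm_one_sub_rpow_le hl hρ2 hρ1 norm_one,
            integral_inv_norm_one_sub_rpow_le hl hρ2 hρ1 he,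
            integral_inv_norm_one_sub_rpow_le hl hρ2 hρ1 hne']
  refine (norm_coeff_le_of_absEvals (fun z hz => absEvals_kernelGenFun he hne' l hz) hρ0 hρ1
    n).trans ?_
  have hD : ((1 - ρ) ^ l)⁻¹ = (n + 2 : ℝ) ^ l := by
    rw [h1ρ, Real.inv_rpow (by positivity), inv_inv]
  rw [hD] at h_int
  have hπ : (2 * π)⁻¹ ≤ 2⁻¹ := inv_anti₀ (by norm_num) (by linarith [Real.pi_gt_three])
  calc _ ≤ (2⁻¹ * (K * (3 * (2 * 4 ^ (l + 1) * l⁻¹ * (n + 2 : ℝ) ^ l)))) * rexp 1 := by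
        gcongr
        exact intervalIntegral.integral_nonneg (by positivity) fun _ _ => norm_nonneg _
    _ = _ := by ring

end KernelEstimate

section CesaroKernelBound

lemma rpow_le_cesaroA {l : ℝ} (hl : 0 < l) (n : ℕ) :
    ((1 + l) ^ l)⁻¹ * (n + 1 + l) ^ l ≤ cesaroA l n := by
  induction n with
  | zero =>
    have h : cesaroA l 0 = 1 := by
      simp only [cesaroA, Nat.cast_zero, add_zero, Nat.factorial_zero, Nat.cast_one, mul_one]
      exact div_self (Real.Gamma_pos_of_pos (by linarith)).ne'
    rw [h, Nat.cast_zero, zero_add, inv_mul_cancel₀ (by positivity)]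
  | succ n ih =>
    have hn : (0 : ℝ) ≤ n := n.cast_nonneg
    have hs := cesaroA_succ (α := l) hl.le n
    set b : ℝ := n + 1 + l with hb
    have hb0 : 0 < b := by positivity
    have hratio : ((b + 1) / b) ^ l ≤ b / (n + 1) := by
      have h1 : (b + 1) / b ≤ rexp b⁻¹ := by
        refine le_trans (le_of_eq ?_) (Real.add_one_le_exp _)
        field_simp; ring
      have h2 : rexp (b⁻¹ * l) ≤ b / (n + 1) := by
        have h3 := Real.add_one_le_exp (-(b⁻¹ * l))
        have h4 : -(b⁻¹ * l) + 1 = (n + 1) / b := by rw [hb]; field_simp; ring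
        rw [h4, Real.exp_neg] at h3
        have := inv_anti₀ (by positivity) h3
        rwa [inv_inv, inv_div] at this
      calc ((b + 1) / b) ^ l ≤ (rexp b⁻¹) ^ l := Real.rpow_le_rpow (by positivity) h1 hl.le
        _ = rexp (b⁻¹ * l) := (Real.exp_mul _ _).symm
        _ ≤ _ := h2
    have hA : cesaroA l (n + 1) = b / (n + 1) * cesaroA l n := by
      rw [div_mul_eq_mul_div, eq_div_iff (by positivity), hb]
      linear_combination hs
    calc ((1 + l) ^ l)⁻¹ * (((n + 1 : ℕ) : ℝ) + 1 + l) ^ l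
        = ((b + 1) / b) ^ l * (((1 + l) ^ l)⁻¹ * b ^ l) := by
          rw [Real.div_rpow (by positivity) hb0.le, show ((n + 1 : ℕ) : ℝ) + 1 + l = b + 1 by
            push_cast; rw [hb]; ring]
          have : b ^ l ≠ 0 := by positivity
          field_simp
      _ ≤ b / (n + 1) * cesaroA l n := by gcongr
      _ = _ := hA.symm

/-- The Cesàro kernel as a function of `t = ⟪x, y⟫`, up to a constant factor. -/
def zonalKernel (N n : ℕ) (t : ℝ) : ℝ :=
  (cesaroA (((N : ℝ) - 1) / 2) n)⁻¹ * ∑ k ∈ Finset.range (n + 1),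
    cesaroA (((N : ℝ) - 1) / 2) (n - k) * ((2 * k + N - 1) * gegR N t k)

/-- The point of the unit circle with real part `t`. -/
def circlePoint (t : ℝ) : ℂ := ⟨t, √(1 - t ^ 2)⟩

lemma circlePoint_mul_conj {t : ℝ} (h1 : -1 ≤ t) (h2 : t ≤ 1) :
    circlePoint t * starRingEnd ℂ (circlePoint t) = 1 := by
  have h : 0 ≤ 1 - t ^ 2 := by nlinarith
  rw [Complex.mul_conj, Complex.normSq_apply]
  simp only [circlePoint, Real.mul_self_sqrt h]
  norm_num [← sq]

lemma circlePoint_add_conj (t : ℝ) :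
    circlePoint t + starRingEnd ℂ (circlePoint t) = 2 * t := by
  rw [Complex.add_conj]; simp [circlePoint]

lemma norm_circlePoint {t : ℝ} (h1 : -1 ≤ t) (h2 : t ≤ 1) : ‖circlePoint t‖ = 1 := by
  have h := circlePoint_mul_conj h1 h2
  rw [Complex.mul_conj, Complex.normSq_eq_norm_sq] at h
  have h' : ‖circlePoint t‖ ^ 2 = 1 := by exact_mod_cast h
  exact (pow_eq_one_iff_of_nonneg (norm_nonneg _) two_ne_zero).1 h'

lemma norm_one_sub_mul_circlePoint_sq {t : ℝ} (h1 : -1 ≤ t) (h2 : t ≤ 1) (r : ℝ) :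
    ‖1 - r * circlePoint t‖ ^ 2 = 1 - 2 * r * t + r ^ 2 := by
  have h : 0 ≤ 1 - t ^ 2 := by nlinarith
  rw [← Complex.normSq_eq_norm_sq, Complex.normSq_apply]
  simp [circlePoint]
  linear_combination r ^ 2 * Real.mul_self_sqrt h

lemma abs_zonalKernel_le_norm_coeff {N : ℕ} (hN : 2 ≤ N) (n : ℕ) {t : ℝ} (h1 : -1 ≤ t)
    (h2 : t ≤ 1) : |zonalKernel N n t| = (cesaroA (((N : ℝ) - 1) / 2) n)⁻¹ * ((N - 1) *
      ‖PowerSeries.coeff n ((1 + PowerSeries.X) * negBinSeries 1 ((((N : ℝ) - 1) / 2 : ℝ) : ℂ) *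
        gegSeries (circlePoint t) (starRingEnd ℂ (circlePoint t))
          ((((N : ℝ) - 1) / 2 : ℝ) + 1))‖) := by
  have hN' : (2 : ℝ) ≤ N := by exact_mod_cast hN
  have hl : (0 : ℝ) ≤ ((N : ℝ) - 1) / 2 := by linarith
  have h := coeff_mul_gegSeries (N := N) (circlePoint_mul_conj h1 h2)
    (circlePoint_add_conj t) n
  have hs : ((∑ k ∈ Finset.range (n + 1), cesaroA (((N : ℝ) - 1) / 2) (n - k) *
      ((2 * k + N - 1) * gegR N t k) : ℝ) : ℂ) = (N - 1) *
      PowerSeries.coeff n ((1 + PowerSeries.X) * negBinSeries 1 (((N : ℂ) - 1) / 2) *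
        gegSeries (circlePoint t) (starRingEnd ℂ (circlePoint t)) (((N : ℂ) - 1) / 2 + 1)) := by
    rw [← h, Complex.ofReal_sum]
    refine Finset.sum_congr rfl fun k _ => ?_
    rw [Complex.ofReal_mul, ofReal_cesaroA hl]
    push_cast
    rfl
  have hpos := cesaroA_pos hl n
  have hnorm := congrArg norm hs
  rw [norm_mul, Complex.norm_real, Real.norm_eq_abs, show (N : ℂ) - 1 = ((N - 1 : ℝ) : ℂ) by
    push_cast; rfl, Complex.norm_real, Real.norm_of_nonneg (by linarith)] at hnorm
  rw [zonalKernel, abs_mul, abs_of_pos (inv_pos.2 hpos), hnorm]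
  push_cast
  rfl

lemma exists_abs_zonalKernel_le {N : ℕ} (hN : 2 ≤ N) : ∃ C : ℝ, 0 ≤ C ∧ ∀ (n : ℕ) (t : ℝ),
    -1 < t → t < 1 → |zonalKernel N n t| ≤
      C * ((2 - 2 * t) ^ N)⁻¹ * (1 + ((2 + 2 * t) ^ (((N : ℝ) - 1) / 2))⁻¹) := by
  have hN' : (2 : ℝ) ≤ N := by exact_mod_cast hN
  set l : ℝ := ((N : ℝ) - 1) / 2 with hl
  have hl0 : 0 < l := by linarith
  refine ⟨(1 + l) ^ l * 2 ^ l * (N - 1) * (3 * 4 ^ (l + 1) * l⁻¹ * rexp 1) * (2 * 4 ^ l * 2 ^ N),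
    ?_, fun n t ht1 ht2 => ?_⟩
  · have : (0 : ℝ) ≤ N - 1 := by linarith
    positivity
  set e := circlePoint t with he
  have hne : ‖e‖ = 1 := norm_circlePoint ht1.le ht2.le
  have hA2 : ‖1 - e‖ ^ 2 = 2 - 2 * t := by
    have := norm_one_sub_mul_circlePoint_sq ht1.le ht2.le 1
    norm_num at this
    rw [he, this]; ring
  have hB2 : ‖1 + e‖ ^ 2 = 2 + 2 * t := by
    have := norm_one_sub_mul_circlePoint_sq ht1.le ht2.le (-1)
    norm_num at this
    rw [he, this]; ring
  set A := ‖1 - e‖ with hA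
  set B := ‖1 + e‖ with hB
  have hA0 : 0 < A := by
    refine (norm_nonneg _).lt_of_ne' fun h => ?_
    rw [← hA] at h
    rw [h] at hA2
    linarith
  have hB0 : 0 < B := by
    refine (norm_nonneg _).lt_of_ne' fun h => ?_
    rw [← hB] at h
    rw [h] at hB2
    linarith
  have hA4 : A ≤ 2 := by nlinarith
  have hn : (0 : ℝ) ≤ n := n.cast_nonneg
  have hD : (0 : ℝ) < 2 - 2 * t := by linarith
  have hE : (0 : ℝ) < 2 + 2 * t := by linarith
  have hcoef := norm_coeff_kernel_le hl0 hne hA0 hB0 n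
  have hCes : (cesaroA l n)⁻¹ * (n + 2) ^ l ≤ (1 + l) ^ l * 2 ^ l := by
    have h1 := rpow_le_cesaroA hl0 n
    have h2 : (n + 2 : ℝ) ^ l ≤ 2 ^ l * (n + 1 + l) ^ l := by
      rw [← Real.mul_rpow (by norm_num) (by positivity)]
      exact Real.rpow_le_rpow (by positivity) (by linarith) hl0.le
    have h3 := cesaroA_pos hl0.le n
    rw [inv_mul_le_iff₀ h3]
    rw [inv_mul_le_iff₀ (by positivity)] at h1
    have h4 : (0 : ℝ) < 2 ^ l := by positivity
    nlinarith
  have hBW : (B ^ l)⁻¹ ≤ 1 + ((2 + 2 * t) ^ l)⁻¹ := by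
    have h0 : 0 < (B ^ l)⁻¹ := by positivity
    have : ((2 + 2 * t) ^ l)⁻¹ = (B ^ l)⁻¹ ^ 2 := by
      rw [← hB2, inv_pow, ← Real.rpow_natCast, ← Real.rpow_natCast, ← Real.rpow_mul hB0.le,
        ← Real.rpow_mul hB0.le, mul_comm]
    rw [this]
    nlinarith [sq_nonneg ((B ^ l)⁻¹ - 1)]
  have hK : 2 / A * ((A * B / 2) ^ l)⁻¹ * ((A / 2) ^ l)⁻¹ ≤
      2 * 4 ^ l * 2 ^ N * ((2 - 2 * t) ^ N)⁻¹ * (1 + ((2 + 2 * t) ^ l)⁻¹) := by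
    have h1 : 2 / A * ((A * B / 2) ^ l)⁻¹ * ((A / 2) ^ l)⁻¹ =
        2 * 4 ^ l * (A ^ N)⁻¹ * (B ^ l)⁻¹ := by
      have h4 : (4 : ℝ) ^ l = 2 ^ l * 2 ^ l := by
        rw [← Real.mul_rpow (by norm_num) (by norm_num)]; norm_num
      have hAN : A ^ N = A * A ^ l * A ^ l := by
        rw [← Real.rpow_natCast, show (N : ℝ) = 1 + l + l by rw [hl]; ring, Real.rpow_add hA0,
          Real.rpow_add hA0, Real.rpow_one]
      rw [Real.div_rpow (by positivity) (by norm_num), Real.div_rpow hA0.le (by norm_num),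
        Real.mul_rpow hA0.le hB0.le, hAN, h4]
      have : A ^ l ≠ 0 := by positivity
      have : B ^ l ≠ 0 := by positivity
      have : (2 : ℝ) ^ l ≠ 0 := by positivity
      field_simp
    have h2 : (A ^ N)⁻¹ ≤ 2 ^ N * ((2 - 2 * t) ^ N)⁻¹ := by
      have h3 : A ^ N ≤ 2 ^ N := by gcongr
      rw [← hA2, ← pow_mul, mul_comm 2 N, pow_mul, ← div_eq_mul_inv, le_div_iff₀ (by positivity),
        sq, ← mul_assoc, inv_mul_cancel₀ (by positivity), one_mul]
      exact h3
    rw [h1]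
    calc 2 * 4 ^ l * (A ^ N)⁻¹ * (B ^ l)⁻¹
        ≤ 2 * 4 ^ l * (2 ^ N * ((2 - 2 * t) ^ N)⁻¹) * (1 + ((2 + 2 * t) ^ l)⁻¹) := by gcongr
      _ = _ := by ring
  rw [abs_zonalKernel_le_norm_coeff hN n ht1.le ht2.le]
  have hN1 : (0 : ℝ) ≤ N - 1 := by linarith
  have h3 := cesaroA_pos hl0.le n
  calc (cesaroA l n)⁻¹ * ((N - 1) * ‖PowerSeries.coeff n ((1 + PowerSeries.X) *
        negBinSeries 1 (l : ℂ) * gegSeries e (starRingEnd ℂ e) ((l : ℂ) + 1))‖)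
      ≤ (cesaroA l n)⁻¹ * ((N - 1) * ((2 * 4 ^ l * 2 ^ N * ((2 - 2 * t) ^ N)⁻¹ *
          (1 + ((2 + 2 * t) ^ l)⁻¹)) * (3 * 4 ^ (l + 1) * l⁻¹ * rexp 1 * (n + 2) ^ l))) := by
        gcongr
        exact hcoef.trans (by gcongr)
    _ = ((cesaroA l n)⁻¹ * (n + 2) ^ l) * ((N - 1) * ((2 * 4 ^ l * 2 ^ N * ((2 - 2 * t) ^ N)⁻¹ *
          (1 + ((2 + 2 * t) ^ l)⁻¹)) * (3 * 4 ^ (l + 1) * l⁻¹ * rexp 1))) := by ring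
    _ ≤ ((1 + l) ^ l * 2 ^ l) * ((N - 1) * ((2 * 4 ^ l * 2 ^ N * ((2 - 2 * t) ^ N)⁻¹ *
          (1 + ((2 + 2 * t) ^ l)⁻¹)) * (3 * 4 ^ (l + 1) * l⁻¹ * rexp 1))) := by gcongr
    _ = _ := by ring

end CesaroKernelBound

section NewtonPotential

lemma norm_conj_circlePoint {t : ℝ} (h1 : -1 ≤ t) (h2 : t ≤ 1) :
    ‖starRingEnd ℂ (circlePoint t)‖ = 1 := by
  rw [Complex.norm_conj, norm_circlePoint h1 h2]

lemma absEvals_gegSeries_circlePoint {t : ℝ} (h1 : -1 ≤ t) (h2 : t ≤ 1) (a : ℂ) {z : ℂ}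
    (hz : ‖z‖ < 1) :
    AbsEvals (gegSeries (circlePoint t) (starRingEnd ℂ (circlePoint t)) a) z
      (1 / (1 - circlePoint t * z) ^ a * (1 / (1 - starRingEnd ℂ (circlePoint t) * z) ^ a)) :=
  (absEvals_negBinSeries (by rwa [norm_mul, norm_circlePoint h1 h2, one_mul]) a).mul
    (absEvals_negBinSeries (by rwa [norm_mul, norm_conj_circlePoint h1 h2, one_mul]) a)

lemma hasSum_gegR (N : ℕ) {t r : ℝ} (h1 : -1 ≤ t) (h2 : t ≤ 1) (hr0 : 0 ≤ r) (hr : r < 1) :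
    HasSum (fun k => gegR N t k * r ^ k) (((1 - 2 * r * t + r ^ 2) ^ (((N : ℝ) - 1) / 2))⁻¹) := by
  have hrn : ‖(r : ℂ)‖ < 1 := by rwa [Complex.norm_real, Real.norm_of_nonneg hr0]
  set l : ℝ := ((N : ℝ) - 1) / 2 with hl
  obtain ⟨hs, ht⟩ := absEvals_gegSeries_circlePoint h1 h2 (l : ℂ) hrn
  have hsum := hs.of_norm.hasSum
  rw [ht] at hsum
  set e := circlePoint t with he
  set w : ℂ := 1 - e * r with hw
  have hw' : 1 - starRingEnd ℂ e * r = starRingEnd ℂ w := by simp [hw]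
  have hre : 0 < w.re := by
    have := Complex.re_le_norm (e * r)
    rw [norm_mul, norm_circlePoint h1 h2, one_mul] at this
    rw [hw, Complex.sub_re, Complex.one_re]
    linarith
  have harg : w.arg ≠ π := fun h => by
    have := (Complex.arg_eq_pi_iff.1 h).1
    linarith
  have hconj : (starRingEnd ℂ w) ^ (l : ℂ) = starRingEnd ℂ (w ^ (l : ℂ)) := by
    rw [Complex.conj_cpow w (l : ℂ) harg, Complex.conj_ofReal]
  have hval : 1 / w ^ (l : ℂ) * (1 / (starRingEnd ℂ w) ^ (l : ℂ)) =
      ((((1 - 2 * r * t + r ^ 2) ^ l)⁻¹ : ℝ) : ℂ) := by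
    have hw2 : ‖w‖ ^ 2 = 1 - 2 * r * t + r ^ 2 := by
      rw [← norm_one_sub_mul_circlePoint_sq h1 h2 r, hw, mul_comm]
    rw [hconj, one_div_mul_one_div, Complex.mul_conj, Complex.normSq_eq_norm_sq,
      Complex.norm_cpow_real, ← hw2, ← Real.rpow_natCast, ← Real.rpow_natCast,
      ← Real.rpow_mul (norm_nonneg _), ← Real.rpow_mul (norm_nonneg _), mul_comm l, one_div,
      Complex.ofReal_inv]
  rw [hw', hval] at hsum
  refine Complex.hasSum_ofReal.1 (hsum.congr_fun fun k => ?_)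
  have := coeff_gegSeries (N := N) (circlePoint_mul_conj h1 h2) (circlePoint_add_conj t) k
  rw [show (((N : ℂ) - 1) / 2) = (l : ℂ) by rw [hl]; push_cast; rfl] at this
  rw [this]
  push_cast
  rfl

lemma abs_gegR_le {N : ℕ} (hN : 2 ≤ N) {t ρ : ℝ} (h1 : -1 ≤ t) (h2 : t ≤ 1) (hρ0 : 0 < ρ)
    (hρ1 : ρ < 1) (k : ℕ) :
    |gegR N t k| ≤ (((1 - ρ) ^ (((N : ℝ) - 1) / 2))⁻¹) ^ 2 * (ρ ^ k)⁻¹ := by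
  have hN' : (2 : ℝ) ≤ N := by exact_mod_cast hN
  set l : ℝ := ((N : ℝ) - 1) / 2 with hl
  have hl0 : 0 ≤ l := by linarith
  have hd : 0 < 1 - ρ := by linarith
  have h := norm_coeff_le_of_absEvals
    (fun z hz => absEvals_gegSeries_circlePoint h1 h2 (l : ℂ) hz) hρ0 hρ1 k
  have hc := coeff_gegSeries (N := N) (circlePoint_mul_conj h1 h2) (circlePoint_add_conj t) k
  rw [show (((N : ℂ) - 1) / 2) = (l : ℂ) by rw [hl]; push_cast; rfl] at hc
  rw [hc, Complex.norm_real, Real.norm_eq_abs] at h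
  refine h.trans (mul_le_mul_of_nonneg_right ?_ (by positivity))
  have hfac {e : ℂ} (he : ‖e‖ = 1) (θ : ℝ) :
      ‖1 / (1 - e * circleMap 0 ρ θ) ^ (l : ℂ)‖ ≤ ((1 - ρ) ^ l)⁻¹ := by
    rw [norm_div, norm_one, Complex.norm_cpow_real, one_div]
    refine inv_anti₀ (by positivity) (Real.rpow_le_rpow hd.le ?_ hl0)
    have := norm_sub_norm_le 1 (e * circleMap 0 ρ θ)
    rwa [norm_mul, he, norm_circleMap_zero, abs_of_pos hρ0, one_mul, norm_one] at this
  have hb := intervalIntegral.norm_integral_le_of_norm_le_const (a := 0) (b := 2 * π)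
    (C := (((1 - ρ) ^ l)⁻¹) ^ 2)
    (f := fun θ => ‖1 / (1 - circlePoint t * circleMap 0 ρ θ) ^ (l : ℂ) *
      (1 / (1 - starRingEnd ℂ (circlePoint t) * circleMap 0 ρ θ) ^ (l : ℂ))‖) fun θ _ => by
    rw [norm_norm, norm_mul, sq]
    exact mul_le_mul (hfac (norm_circlePoint h1 h2) θ) (hfac (norm_conj_circlePoint h1 h2) θ)
      (norm_nonneg _) (by positivity)
  rw [sub_zero, abs_of_pos (by positivity)] at hb
  rw [inv_mul_le_iff₀ (by positivity), mul_comm (2 * π)]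
  exact (le_abs_self _).trans hb

lemma inner_mem_Icc {N : ℕ} (x y : Sph N) : -1 ≤ ⟪(x : Amb N), (y : Amb N)⟫ ∧
    ⟪(x : Amb N), (y : Amb N)⟫ ≤ 1 := by
  have hx : ‖(x : Amb N)‖ = 1 := by simp
  have hy : ‖(y : Amb N)‖ = 1 := by simp
  have h := abs_real_inner_le_norm (x : Amb N) (y : Amb N)
  rw [hx, hy, mul_one] at h
  exact abs_le.1 h

lemma integral_gegR {N : ℕ} (hN : 2 ≤ N) (x : Sph N) {k : ℕ} (hk : k ≠ 0) :
    ∫ y : Sph N, gegR N ⟪(y : Amb N), (x : Amb N)⟫ k ∂(sphMeasure N) = 0 := by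
  have h := sphInt_mul_eq_zero hN hk (isHomogeneous_gegPoly (fun i => (x : Amb N) i) k)
    (polyLap_gegPoly (sum_coe_sq x) k) (MvPolynomial.isHomogeneous_one _ _) (by simp [polyLap])
  rw [mul_one, sphInt] at h
  simpa only [polyEval_gegPoly] using h

lemma integral_newtonKernel {N : ℕ} (hN : 2 ≤ N) (x : Sph N) {r : ℝ} (hr0 : 0 ≤ r) (hr : r < 1) :
    ∫ y : Sph N, ((1 - 2 * r * ⟪(y : Amb N), (x : Amb N)⟫ + r ^ 2) ^ (((N : ℝ) - 1) / 2))⁻¹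
      ∂(sphMeasure N) = (sphMeasure N).real Set.univ := by
  have h_int (k : ℕ) : Integrable (fun y : Sph N => gegR N ⟪(y : Amb N), (x : Amb N)⟫ k * r ^ k)
      (sphMeasure N) := by
    have := (integrable_polyEval (gegPoly (fun i => (x : Amb N) i) k)).mul_const (r ^ k)
    simpa only [polyEval_gegPoly] using this
  set ρ := (1 + r) / 2 with hρ
  have hρ0 : 0 < ρ := by linarith
  have hρ1 : ρ < 1 := by linarith
  set M := (((1 - ρ) ^ (((N : ℝ) - 1) / 2))⁻¹) ^ 2
  have hsum : Summable fun k => ∫ y : Sph N, ‖gegR N ⟪(y : Amb N), (x : Amb N)⟫ k * r ^ k‖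
      ∂(sphMeasure N) := by
    refine Summable.of_nonneg_of_le (fun k => integral_nonneg fun _ => norm_nonneg _) (fun k => ?_)
      ((summable_geometric_of_lt_one (div_nonneg hr0 hρ0.le)
        ((div_lt_one hρ0).2 (by linarith))).mul_left (M * (sphMeasure N).real Set.univ))
    calc _ ≤ ∫ _ : Sph N, M * (r / ρ) ^ k ∂(sphMeasure N) := by
          refine integral_mono (h_int k).norm (integrable_const _) fun y => ?_
          have hy := inner_mem_Icc y x
          have := abs_gegR_le hN hy.1 hy.2 hρ0 hρ1 k
          simp only [norm_mul, norm_pow, Real.norm_eq_abs, abs_of_nonneg hr0]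
          calc _ ≤ M * (ρ ^ k)⁻¹ * r ^ k := by gcongr
            _ = _ := by rw [div_pow r ρ k, div_eq_mul_inv (r ^ k), mul_assoc,
                mul_comm (ρ ^ k)⁻¹]
      _ = _ := by rw [integral_const, smul_eq_mul]; ring
  have h := hasSum_integral_of_summable_integral_norm h_int hsum
  have h0 : HasSum (fun k => ∫ y : Sph N, gegR N ⟪(y : Amb N), (x : Amb N)⟫ k * r ^ k
      ∂(sphMeasure N)) ((sphMeasure N).real Set.univ) := by
    convert hasSum_ite_eq (0 : ℕ) ((sphMeasure N).real Set.univ) using 2 with k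
    split_ifs with hk
    · simp [hk, gegR]
    · rw [integral_mul_const, integral_gegR hN x hk, zero_mul]
  rw [← h.unique h0]
  refine integral_congr_ae (Eventually.of_forall fun y => ?_)
  have hy := inner_mem_Icc y x
  exact (hasSum_gegR N hy.1 hy.2 hr0 hr).tsum_eq.symm

lemma lintegral_newtonPotential_le {N : ℕ} (hN : 2 ≤ N) (x : Sph N) :
    ∫⁻ y : Sph N, (ENNReal.ofReal (2 - 2 * ⟪(y : Amb N), (x : Amb N)⟫)) ^ (-(((N : ℝ) - 1) / 2))
      ∂(sphMeasure N) ≤ sphMeasure N Set.univ := by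
  set l : ℝ := ((N : ℝ) - 1) / 2 with hl
  set r : ℕ → ℝ := fun n => 1 - 1 / ((n : ℝ) + 1) with hr
  have hr0 (n : ℕ) : 0 ≤ r n := by
    have h : (1 : ℝ) / (n + 1) ≤ 1 := by
      rw [div_le_one (by positivity)]
      linarith [n.cast_nonneg (α := ℝ)]
    simp only [hr]; linarith
  have hr1 (n : ℕ) : r n < 1 := by
    have : (0 : ℝ) < 1 / (n + 1) := by positivity
    simp only [hr]; linarith
  have hrt : Tendsto r atTop (𝓝 1) := by
    simpa [hr] using (tendsto_const_nhds (x := (1 : ℝ))).sub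
      (tendsto_one_div_add_atTop_nhds_zero_nat (𝕜 := ℝ))
  set F : ℕ → Sph N → ℝ≥0∞ := fun n y =>
    (ENNReal.ofReal (1 - 2 * r n * ⟪(y : Amb N), (x : Amb N)⟫ + r n ^ 2)) ^ (-l) with hF
  have hpos (n : ℕ) (y : Sph N) : 0 < 1 - 2 * r n * ⟪(y : Amb N), (x : Amb N)⟫ + r n ^ 2 := by
    have hy := inner_mem_Icc y x
    nlinarith [hr0 n, hr1 n, sq_pos_of_pos (sub_pos.2 (hr1 n)),
      mul_nonneg (hr0 n) (sub_nonneg.2 hy.2)]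
  have hcont (n : ℕ) : Continuous fun y : Sph N =>
      1 - 2 * r n * ⟪(y : Amb N), (x : Amb N)⟫ + r n ^ 2 := by fun_prop
  have hFm (n : ℕ) : Measurable (F n) :=
    (ENNReal.continuous_rpow_const.comp (ENNReal.continuous_ofReal.comp (hcont n))).measurable
  have hFint (n : ℕ) : ∫⁻ y, F n y ∂(sphMeasure N) = sphMeasure N Set.univ := by
    have hi := integral_newtonKernel hN x (hr0 n) (hr1 n)
    have hc : Continuous fun y : Sph N =>
        ((1 - 2 * r n * ⟪(y : Amb N), (x : Amb N)⟫ + r n ^ 2) ^ l)⁻¹ :=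
      ((hcont n).rpow_const fun y => Or.inl (hpos n y).ne').inv₀
        fun y => (Real.rpow_pos_of_pos (hpos n y) _).ne'
    have h2 := ofReal_integral_eq_lintegral_ofReal (Continuous.integrable_sphere hc)
      (Eventually.of_forall fun y => inv_nonneg.2 (Real.rpow_nonneg (hpos n y).le _))
    rw [hi, ofReal_measureReal] at h2
    rw [h2]
    refine lintegral_congr fun y => ?_
    rw [hF]
    simp only
    rw [ENNReal.ofReal_rpow_of_pos (hpos n y), Real.rpow_neg (hpos n y).le]
  calc ∫⁻ y : Sph N, (ENNReal.ofReal (2 - 2 * ⟪(y : Amb N), (x : Amb N)⟫)) ^ (-l) ∂(sphMeasure N)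
      = ∫⁻ y : Sph N, liminf (fun n => F n y) atTop ∂(sphMeasure N) := by
        refine lintegral_congr fun y => ?_
        refine (Tendsto.liminf_eq ?_).symm
        have h1 : Tendsto (fun n => 1 - 2 * r n * ⟪(y : Amb N), (x : Amb N)⟫ + r n ^ 2) atTop
            (𝓝 (2 - 2 * ⟪(y : Amb N), (x : Amb N)⟫)) := by
          have := ((hrt.const_mul 2).mul_const ⟪(y : Amb N), (x : Amb N)⟫).const_sub 1 |>.add
            (hrt.pow 2)
          convert this using 2
          ring
        exact (ENNReal.continuous_rpow_const.tendsto _).comp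
          ((ENNReal.continuous_ofReal.tendsto _).comp h1)
    _ ≤ liminf (fun n => ∫⁻ y, F n y ∂(sphMeasure N)) atTop := lintegral_liminf_le hFm
    _ = sphMeasure N Set.univ := by simp only [hFint, liminf_const]

end NewtonPotential

section Approximation

lemma exists_polyEval_near {N : ℕ} {g : Sph N → ℝ} (hg : Continuous g) {ε : ℝ} (hε : 0 < ε) :
    ∃ p : MvPolynomial (Fin (N + 1)) ℝ, ∀ y : Sph N, |polyEval p (y : Amb N) - g y| < ε := by
  set c : Fin (N + 1) → C(Sph N, ℝ) := fun i => ⟨fun y => (y : Amb N) i, by fun_prop⟩ with hc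
  have hval (p : MvPolynomial (Fin (N + 1)) ℝ) (y : Sph N) :
      MvPolynomial.aeval c p y = polyEval p (y : Amb N) := by
    induction p using MvPolynomial.induction_on with
    | C a => simp [polyEval]
    | add p q hp hq => simp only [map_add, ContinuousMap.add_apply, hp, hq, polyEval]
    | mul_X p i hp =>
      rw [map_mul, ContinuousMap.mul_apply, hp, MvPolynomial.aeval_X]
      simp [polyEval, hc]
  have hsep : (MvPolynomial.aeval (R := ℝ) c).range.SeparatesPoints := by
    intro y z hyz
    obtain ⟨i, hi⟩ : ∃ i, (y : Amb N) i ≠ (z : Amb N) i := by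
      by_contra! h
      exact hyz (Subtype.ext (PiLp.ext h))
    exact ⟨c i, ⟨c i, ⟨MvPolynomial.X i, by simp⟩, rfl⟩, hi⟩
  obtain ⟨⟨_, p, rfl⟩, hφ⟩ :=
    ContinuousMap.exists_mem_subalgebra_near_continuous_of_separatesPoints _ hsep g hg ε hε
  refine ⟨p, fun y => ?_⟩
  rw [← hval]
  exact hφ y

/-- Polynomials are dense in a weighted `L¹` space on the sphere. -/
lemma exists_integral_abs_sub_polyEval_mul_le {N : ℕ} {W h : Sph N → ℝ} (hW0 : ∀ y, 0 ≤ W y)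
    (hWm : Measurable W) (hW : Integrable W (sphMeasure N))
    (hh : Integrable (fun y => W y * h y) (sphMeasure N)) {ε : ℝ} (hε : 0 < ε) :
    ∃ p : MvPolynomial (Fin (N + 1)) ℝ,
      ∫ y : Sph N, W y * |h y - polyEval p (y : Amb N)| ∂(sphMeasure N) ≤ ε := by
  set w : Sph N → ℝ≥0 := fun y => (W y).toNNReal with hw
  have hwm : Measurable w := hWm.real_toNNReal
  have hwW (y : Sph N) : (w y : ℝ) = W y := Real.coe_toNNReal _ (hW0 y)
  set μ := (sphMeasure N).withDensity fun y => (w y : ℝ≥0∞) with hμ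
  have : IsFiniteMeasure μ := by
    refine isFiniteMeasure_withDensity (ne_of_lt ?_)
    have := hW.lintegral_lt_top
    exact this
  have hμi (k : Sph N → ℝ) : ∫ y, k y ∂μ = ∫ y, W y * k y ∂(sphMeasure N) := by
    rw [hμ, integral_withDensity_eq_integral_smul hwm]
    simp only [NNReal.smul_def, hwW, smul_eq_mul]
  have hhμ : Integrable h μ := by
    rw [hμ, integrable_withDensity_iff_integrable_smul hwm]
    simpa only [NNReal.smul_def, hwW, smul_eq_mul] using hh
  obtain ⟨g, -, hgi, hgc, hgI⟩ := hhμ.exists_hasCompactSupport_integral_sub_le (half_pos hε)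
  have hM : 0 ≤ μ.real Set.univ := measureReal_nonneg
  obtain ⟨p, hp⟩ := exists_polyEval_near hgc (ε := ε / 2 / (μ.real Set.univ + 1)) (by positivity)
  refine ⟨p, ?_⟩
  rw [← hμi fun y => |h y - polyEval p (y : Amb N)|]
  have hgsub : Integrable (fun y => ‖h y - g y‖) μ := (hhμ.sub hgI).norm
  calc ∫ y, |h y - polyEval p (y : Amb N)| ∂μ
      ≤ ∫ y, (‖h y - g y‖ + ε / 2 / (μ.real Set.univ + 1)) ∂μ := by
        refine integral_mono_of_nonneg (Eventually.of_forall fun y => abs_nonneg _)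
          (hgsub.add (integrable_const _)) (Eventually.of_forall fun y => ?_)
        have := hp y
        rw [abs_sub_comm] at this
        calc |h y - polyEval p (y : Amb N)| ≤ |h y - g y| + |g y - polyEval p (y : Amb N)| :=
              abs_sub_le _ _ _
          _ ≤ _ := add_le_add le_rfl this.le
    _ = ∫ y, ‖h y - g y‖ ∂μ + μ.real Set.univ * (ε / 2 / (μ.real Set.univ + 1)) := by
        rw [integral_add hgsub (integrable_const _), integral_const, smul_eq_mul]
    _ ≤ ε / 2 + ε / 2 := by
        gcongr
        rw [mul_div_assoc', div_le_iff₀ (by positivity)]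
        nlinarith
    _ = ε := add_halves ε

end Approximation

section Localization

variable {N : ℕ} {a : ℕ → ℕ} {Y : (k : ℕ) → Fin (a k) → Sph N → ℝ}

lemma sphMeasure_real_univ_pos (hN : 2 ≤ N) (hY : IsFourierLaplaceBasis N a Y) (x : Sph N) :
    0 < (sphMeasure N).real Set.univ := by
  refine measureReal_nonneg.lt_of_ne' fun h => ?_
  have := addition_formula hN hY 0 x x
  rw [h, polyEval_gegPoly] at this
  simp [gegR] at this

lemma cesaroKernel_eq_zonalKernel (hN : 2 ≤ N) (hY : IsFourierLaplaceBasis N a Y) (n : ℕ)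
    (x y : Sph N) : cesaroKernel Y (((N : ℝ) - 1) / 2) n x y =
      ((sphMeasure N).real Set.univ * (N - 1))⁻¹ *
        zonalKernel N n ⟪(y : Amb N), (x : Amb N)⟫ := by
  have hs := sphMeasure_real_univ_pos hN hY x
  have hN' : (2 : ℝ) ≤ N := by exact_mod_cast hN
  have hN1 : (N : ℝ) - 1 ≠ 0 := by linarith
  rw [cesaroKernel, zonalKernel, mul_left_comm]
  congr 1
  rw [Finset.mul_sum]
  refine Finset.sum_congr rfl fun k _ => ?_
  have h := addition_formula hN hY k y x
  have hk : (2 * k + N - 1 : ℝ) ≠ 0 := by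
    have : (0 : ℝ) ≤ k := k.cast_nonneg
    linarith
  rw [polyEval_gegPoly] at h
  rw [h]
  have hcomm : ∑ j, Y k j y * Y k j x = ∑ j, Y k j x * Y k j y :=
    Finset.sum_congr rfl fun j _ => mul_comm _ _
  rw [hcomm]
  field_simp

lemma cesaroMean_eq_integral (hY : IsFourierLaplaceBasis N a Y) (α : ℝ) {f : Sph N → ℝ}
    (hf : Integrable f (sphMeasure N)) (n : ℕ) (x : Sph N) :
    cesaroMean Y α f n x = ∫ y, cesaroKernel Y α n x y * f y ∂(sphMeasure N) := by
  have hi (k : ℕ) (j : Fin (a k)) :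
      Integrable (fun y => Y k j x * (f y * Y k j y)) (sphMeasure N) :=
    (hY.integrable_mul k j hf).const_mul _
  have h (y : Sph N) : cesaroKernel Y α n x y * f y = (cesaroA α n)⁻¹ *
      ∑ k ∈ Finset.range (n + 1), cesaroA α (n - k) * ∑ j, Y k j x * (f y * Y k j y) := by
    rw [cesaroKernel, mul_assoc, Finset.sum_mul]
    congr 1
    refine Finset.sum_congr rfl fun k _ => ?_
    rw [mul_assoc, Finset.sum_mul]
    congr 1
    exact Finset.sum_congr rfl fun j _ => by ring
  simp only [h]
  rw [integral_const_mul, integral_finsetSum _ fun k _ =>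
    (integrable_finsetSum _ fun j _ => hi k j).const_mul _, cesaroMean]
  congr 1
  refine Finset.sum_congr rfl fun k _ => ?_
  rw [integral_const_mul, integral_finsetSum _ fun j _ => hi k j]
  congr 1
  refine Finset.sum_congr rfl fun j _ => ?_
  rw [integral_const_mul, flCoeff, mul_comm]

/-- The weight controlling the antipodal singularity of the Cesàro kernel with pole `x`. -/
def antipodalWeight (x y : Sph N) : ℝ :=
  1 + ((2 + 2 * ⟪(y : Amb N), (x : Amb N)⟫) ^ (((N : ℝ) - 1) / 2))⁻¹

lemma coe_antipode (x : Sph N) : (antipode x : Amb N) = -(x : Amb N) := rfl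

lemma lintegral_antipodal_le (hN : 2 ≤ N) (x : Sph N) :
    ∫⁻ y : Sph N, (ENNReal.ofReal (2 + 2 * ⟪(y : Amb N), (x : Amb N)⟫)) ^ (-(((N : ℝ) - 1) / 2))
      ∂(sphMeasure N) ≤ sphMeasure N Set.univ := by
  have := lintegral_newtonPotential_le hN (antipode x)
  simpa only [coe_antipode, inner_neg_right, mul_neg, sub_neg_eq_add] using this

lemma measurable_antipodal : Measurable fun z : Sph N × Sph N =>
    (ENNReal.ofReal (2 + 2 * ⟪(z.2 : Amb N), (z.1 : Amb N)⟫)) ^ (-(((N : ℝ) - 1) / 2)) := by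
  refine Continuous.measurable (ENNReal.continuous_rpow_const.comp
    (ENNReal.continuous_ofReal.comp ?_))
  fun_prop

lemma antipodalWeight_eq (x y : Sph N) : antipodalWeight x y = 1 +
    ((ENNReal.ofReal (2 + 2 * ⟪(y : Amb N), (x : Amb N)⟫)) ^ (-(((N : ℝ) - 1) / 2))).toReal := by
  have h : 0 ≤ 2 + 2 * ⟪(y : Amb N), (x : Amb N)⟫ := by linarith [(inner_mem_Icc y x).1]
  rw [antipodalWeight, ← ENNReal.toReal_rpow, ENNReal.toReal_ofReal h, Real.rpow_neg h]

lemma one_le_antipodalWeight (x y : Sph N) : 1 ≤ antipodalWeight x y := by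
  rw [antipodalWeight_eq]
  linarith [ENNReal.toReal_nonneg (a := (ENNReal.ofReal
    (2 + 2 * ⟪(y : Amb N), (x : Amb N)⟫)) ^ (-(((N : ℝ) - 1) / 2)))]

lemma measurable_antipodalWeight (x : Sph N) : Measurable (antipodalWeight x) := by
  have : antipodalWeight x = fun y => _ := funext fun y => antipodalWeight_eq x y
  rw [this]
  exact (measurable_antipodal.comp measurable_prodMk_left).ennreal_toReal.const_add 1

lemma ae_neg_one_lt_inner (hN : 2 ≤ N) (x : Sph N) :
    ∀ᵐ y : Sph N ∂(sphMeasure N), -1 < ⟪(y : Amb N), (x : Amb N)⟫ := by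
  have hN' : (2 : ℝ) ≤ N := by exact_mod_cast hN
  have h := ae_lt_top (measurable_antipodal.comp (measurable_prodMk_left (x := x)))
    ((lintegral_antipodal_le hN x).trans_lt (measure_lt_top _ _)).ne
  filter_upwards [h] with y hy
  by_contra! hle
  have : (2 + 2 * ⟪(y : Amb N), (x : Amb N)⟫) ≤ 0 := by linarith
  simp only [Function.comp_apply] at hy
  rw [ENNReal.ofReal_of_nonpos this, ENNReal.zero_rpow_of_neg (by linarith)] at hy
  exact lt_irrefl _ hy

lemma integrable_antipodalWeight_mul {x : Sph N} {f : Sph N → ℝ}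
    (hf : Integrable f (sphMeasure N))
    (hfx : ∫⁻ y : Sph N, ‖f y‖ₑ * (ENNReal.ofReal (2 + 2 * ⟪(y : Amb N), (x : Amb N)⟫)) ^
      (-(((N : ℝ) - 1) / 2)) ∂(sphMeasure N) < ∞) :
    Integrable (fun y => antipodalWeight x y * f y) (sphMeasure N) := by
  refine ⟨(measurable_antipodalWeight x).aestronglyMeasurable.mul hf.1, ?_⟩
  refine lt_of_le_of_lt ?_ (ENNReal.add_lt_top.2 ⟨hf.2, hfx⟩)
  rw [← lintegral_add_left' hf.1.enorm]
  refine lintegral_mono fun y => ?_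
  beta_reduce
  rw [antipodalWeight_eq, enorm_mul, ← mul_one_add ‖f y‖ₑ, mul_comm _ ‖f y‖ₑ]
  gcongr
  rw [Real.enorm_of_nonneg (by positivity)]
  refine ENNReal.ofReal_add_le.trans ?_
  rw [ENNReal.ofReal_one]
  gcongr
  exact ENNReal.ofReal_toReal_le

lemma ae_lintegral_antipodal_lt_top (hN : 2 ≤ N) {f : Sph N → ℝ}
    (hf : Integrable f (sphMeasure N)) : ∀ᵐ x : Sph N ∂(sphMeasure N),
      ∫⁻ y : Sph N, ‖f y‖ₑ * (ENNReal.ofReal (2 + 2 * ⟪(y : Amb N), (x : Amb N)⟫)) ^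
        (-(((N : ℝ) - 1) / 2)) ∂(sphMeasure N) < ∞ := by
  have hm : AEMeasurable (fun z : Sph N × Sph N => ‖f z.2‖ₑ *
      (ENNReal.ofReal (2 + 2 * ⟪(z.2 : Amb N), (z.1 : Amb N)⟫)) ^ (-(((N : ℝ) - 1) / 2)))
      ((sphMeasure N).prod (sphMeasure N)) :=
    (hf.1.enorm.comp_snd).mul measurable_antipodal.aemeasurable
  refine ae_lt_top' hm.lintegral_prod_right' (ne_of_lt ?_)
  rw [lintegral_lintegral_swap hm]
  calc _ ≤ ∫⁻ y : Sph N, ‖f y‖ₑ * sphMeasure N Set.univ ∂(sphMeasure N) := by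
        refine lintegral_mono fun y => ?_
        refine (lintegral_const_mul ‖f y‖ₑ
          (measurable_antipodal.comp (measurable_prodMk_right (y := y)))).trans_le ?_
        gcongr
        refine le_trans (le_of_eq ?_) (lintegral_antipodal_le hN y)
        simp only [Function.comp_apply, real_inner_comm]
    _ = (∫⁻ y : Sph N, ‖f y‖ₑ ∂(sphMeasure N)) * sphMeasure N Set.univ :=
        lintegral_mul_const' _ _ (measure_ne_top _ _)
    _ < ∞ := ENNReal.mul_lt_top hf.2 (measure_lt_top _ _)

lemma exists_abs_cesaroMean_le (hN : 2 ≤ N) (hY : IsFourierLaplaceBasis N a Y) (x : Sph N) :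
    ∃ C : ℝ, 0 ≤ C ∧ ∀ (h : Sph N → ℝ),
      Integrable (fun y => antipodalWeight x y * h y) (sphMeasure N) →
      Integrable (fun y : Sph N => (2 - 2 * ⟪(y : Amb N), (x : Amb N)⟫) ^ N * h y) (sphMeasure N) →
      ∀ n, |cesaroMean Y (((N : ℝ) - 1) / 2)
        (fun y : Sph N => (2 - 2 * ⟪(y : Amb N), (x : Amb N)⟫) ^ N * h y) n x| ≤
        C * ∫ y, antipodalWeight x y * |h y| ∂(sphMeasure N) := by
  obtain ⟨C, hC0, hC⟩ := exists_abs_zonalKernel_le hN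
  have hN' : (2 : ℝ) ≤ N := by exact_mod_cast hN
  set c : ℝ := ((sphMeasure N).real Set.univ * (N - 1))⁻¹ with hc
  have hc0 : 0 ≤ c := inv_nonneg.2 (mul_nonneg measureReal_nonneg (by linarith))
  refine ⟨c * C, by positivity, fun h hW hD n => ?_⟩
  rw [cesaroMean_eq_integral hY _ hD, ← integral_const_mul]
  have hWabs : Integrable (fun y => antipodalWeight x y * |h y|) (sphMeasure N) := by
    refine hW.norm.congr (Eventually.of_forall fun y => ?_)
    simp only [norm_mul, Real.norm_eq_abs]
    rw [abs_of_nonneg (zero_le_one.trans (one_le_antipodalWeight x y))]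
  rw [← Real.norm_eq_abs]
  refine norm_integral_le_of_norm_le (hWabs.const_mul (c * C)) ?_
  filter_upwards [ae_neg_one_lt_inner hN x] with y hy
  rw [cesaroKernel_eq_zonalKernel hN hY, Real.norm_eq_abs]
  have h0 := one_le_antipodalWeight x y
  rcases (inner_mem_Icc y x).2.eq_or_lt with h1 | h1
  · rw [h1, mul_one, sub_self, zero_pow (by omega), zero_mul, mul_zero, abs_zero]
    positivity
  · have hpos : 0 < 2 - 2 * ⟪(y : Amb N), (x : Amb N)⟫ := by linarith
    have hz := hC n _ hy h1
    rw [← antipodalWeight] at hz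
    rw [abs_mul, abs_mul, abs_mul, abs_of_nonneg hc0, abs_of_pos (pow_pos hpos N)]
    calc c * |zonalKernel N n ⟪(y : Amb N), (x : Amb N)⟫| *
          ((2 - 2 * ⟪(y : Amb N), (x : Amb N)⟫) ^ N * |h y|)
        ≤ c * (C * ((2 - 2 * ⟪(y : Amb N), (x : Amb N)⟫) ^ N)⁻¹ * antipodalWeight x y) *
          ((2 - 2 * ⟪(y : Amb N), (x : Amb N)⟫) ^ N * |h y|) := by gcongr
      _ = c * C * (antipodalWeight x y * |h y|) := by
        field_simp

lemma norm_sub_sq_sphere (x y : Sph N) :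
    ‖(y : Amb N) - x‖ ^ 2 = 2 - 2 * ⟪(y : Amb N), (x : Amb N)⟫ := by
  have hx : ‖(x : Amb N)‖ = 1 := by simp
  have hy : ‖(y : Amb N)‖ = 1 := by simp
  rw [norm_sub_sq_real, hx, hy]; ring

lemma tendsto_cesaroMean_zero (hN : 2 ≤ N) (hY : IsFourierLaplaceBasis N a Y) {f : Sph N → ℝ}
    (hf : Integrable f (sphMeasure N)) {V : Set (Sph N)} (hV : IsOpen V)
    (hfV : ∀ x ∈ V, f x = 0) {x : Sph N} (hx : x ∈ V)
    (hfx : ∫⁻ y : Sph N, ‖f y‖ₑ * (ENNReal.ofReal (2 + 2 * ⟪(y : Amb N), (x : Amb N)⟫)) ^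
      (-(((N : ℝ) - 1) / 2)) ∂(sphMeasure N) < ∞) :
    Tendsto (fun n : ℕ => cesaroMean Y (((N : ℝ) - 1) / 2) f n x) atTop (𝓝 0) := by
  have hN' : (2 : ℝ) ≤ N := by exact_mod_cast hN
  set D : Sph N → ℝ := fun y => (2 - 2 * ⟪(y : Amb N), (x : Amb N)⟫) ^ N with hD
  set W : Sph N → ℝ := antipodalWeight x with hW
  have hDc : Continuous D := by simp only [hD]; fun_prop
  have hWf : Integrable (fun y => W y * f y) (sphMeasure N) :=
    integrable_antipodalWeight_mul hf hfx
  have hWi : Integrable W (sphMeasure N) := by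
    have := integrable_antipodalWeight_mul (x := x) (integrable_const (1 : ℝ)) (by
      simpa using (lintegral_antipodal_le hN x).trans_lt (measure_lt_top _ _))
    simpa using this
  obtain ⟨δ, hδ0, hδ⟩ := Metric.isOpen_iff.1 hV x hx
  set h : Sph N → ℝ := fun y => f y / D y with hh
  have hDlow (y : Sph N) (hy : f y ≠ 0) : δ ^ (2 * N) ≤ D y := by
    have hyV : y ∉ V := fun hyV => hy (hfV y hyV)
    have hd : δ ≤ ‖(y : Amb N) - x‖ := by
      by_contra! hlt
      exact hyV (hδ (by rwa [mem_ball, Subtype.dist_eq, dist_eq_norm]))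
    simp only [hD]
    rw [← norm_sub_sq_sphere, pow_mul]
    gcongr
  have hDh (y : Sph N) : D y * h y = f y := by
    by_cases hy : f y = 0
    · simp [hh, hy]
    · exact mul_div_cancel₀ _ ((pow_pos hδ0 _).trans_le (hDlow y hy)).ne'
  have hWh : Integrable (fun y => W y * h y) (sphMeasure N) := by
    refine (hWf.norm.const_mul (δ ^ (2 * N))⁻¹).mono'
      ((measurable_antipodalWeight x).aestronglyMeasurable.mul
        (hf.1.div₀ hDc.aestronglyMeasurable)) (Eventually.of_forall fun y => ?_)
    by_cases hy : f y = 0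
    · simp [hh, hy]
    · have h1 := hDlow y hy
      have h2 : 0 < δ ^ (2 * N) := pow_pos hδ0 _
      simp only [hh, norm_mul, norm_div]
      rw [Real.norm_of_nonneg (h2.trans_le h1).le, mul_div_assoc', div_eq_inv_mul]
      gcongr
  obtain ⟨C, hC0, hC⟩ := exists_abs_cesaroMean_le hN hY x
  rw [Metric.tendsto_atTop]
  intro ε hε
  obtain ⟨p, hp⟩ := exists_integral_abs_sub_polyEval_mul_le
    (fun y => zero_le_one.trans (one_le_antipodalWeight x y)) (measurable_antipodalWeight x)
    hWi hWh (ε := ε / 2 / (C + 1)) (by positivity)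
  set q : MvPolynomial (Fin (N + 1)) ℝ :=
    (MvPolynomial.C 2 - MvPolynomial.C 2 * linForm fun i => (x : Amb N) i) ^ N * p with hq
  have hqy (y : Sph N) : polyEval q (y : Amb N) = D y * polyEval p (y : Amb N) := by
    simp [hq, hD, polyEval, linForm, PiLp.inner_apply]
  have hqx : polyEval q (x : Amb N) = 0 := by
    have hxx : ⟪(x : Amb N), (x : Amb N)⟫ = 1 := by rw [real_inner_self_eq_norm_sq]; simp
    rw [hqy]
    simp only [hD]
    rw [hxx, mul_one, sub_self, zero_pow (by omega), zero_mul]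
  have hlim := tendsto_cesaroMean_polyEval hN hY (α := ((N : ℝ) - 1) / 2) (by linarith) q x
  rw [hqx, Metric.tendsto_atTop] at hlim
  obtain ⟨n₀, hn₀⟩ := hlim (ε / 2) (half_pos hε)
  refine ⟨n₀, fun n hn => ?_⟩
  have hq1 := hn₀ n hn
  rw [dist_zero_right, Real.norm_eq_abs] at hq1 ⊢
  have hDp : Integrable (fun y : Sph N => polyEval q (y : Amb N)) (sphMeasure N) :=
    integrable_polyEval q
  have hDhp : Integrable (fun y : Sph N => D y * (h y - polyEval p (y : Amb N)))
      (sphMeasure N) := by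
    refine (hf.sub hDp).congr (Eventually.of_forall fun y => ?_)
    simp only [Pi.sub_apply]
    rw [mul_sub, hDh, hqy]
  have hWp : Integrable (fun y : Sph N => W y * (h y - polyEval p (y : Amb N)))
      (sphMeasure N) := by
    obtain ⟨B, hB⟩ := ((continuous_polyEval p).comp
      (continuous_subtype_val (p := fun y : Amb N => y ∈ Metric.sphere (0 : Amb N) 1))
      ).bounded_above_of_compact_support (HasCompactSupport.of_compactSpace _)
    simp only [mul_sub]
    exact hWh.sub (hWi.mul_bdd (c := B) ((continuous_polyEval p).comp
      continuous_subtype_val).aestronglyMeasurable (Eventually.of_forall hB))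
  have hsplit : f = fun y => D y * (h y - polyEval p (y : Amb N)) + polyEval q (y : Amb N) := by
    funext y
    rw [mul_sub, hDh, hqy]; ring
  have hmain := hC _ hWp hDhp n
  rw [hsplit, cesaroMean_add hY _ hDhp hDp]
  have hCε : C * (ε / 2 / (C + 1)) ≤ ε / 2 := by
    rw [mul_div_assoc', div_le_iff₀ (by positivity)]
    nlinarith
  calc _ ≤ C * (ε / 2 / (C + 1)) + |cesaroMean Y (((N : ℝ) - 1) / 2)
          (fun y => polyEval q (y : Amb N)) n x| :=
        (abs_add_le _ _).trans (add_le_add_left (hmain.trans (by gcongr)) _)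
    _ < ε / 2 + ε / 2 := by linarith
    _ = ε := add_halves ε

end Localization

/-- (Generalized localization at the critical exponent.) For `N ≥ 2`,
`f ∈ L¹(S^N)` vanishing on an open subset `V ⊂ S^N`, the Fourier–Laplace series of `f`
is Cesàro summable of the critical order `α = (N−1)/2` to zero a.e. on `V`. -/
theorem generalized_localization_critical
    (N : ℕ) (hN : 2 ≤ N) (a : ℕ → ℕ) (Y : (k : ℕ) → Fin (a k) → Sph N → ℝ)
    (hY : IsFourierLaplaceBasis N a Y)
    (f : Sph N → ℝ) (hf : Integrable f (sphMeasure N))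
    (V : Set (Sph N)) (hV : IsOpen V) (hfV : ∀ x ∈ V, f x = 0) :
    ∀ᵐ x ∂(sphMeasure N), x ∈ V →
      Tendsto (fun n : ℕ => cesaroMean Y (((N : ℝ) - 1) / 2) f n x) atTop (𝓝 0) := by
  filter_upwards [ae_lintegral_antipodal_lt_top hN hf] with x hx hxV
  exact tendsto_cesaroMean_zero hN hY hf hV hfV hxV hx
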